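/- arXiv:1811.01816 — 2 statements merged into one kernel-verified Lean document; each statement's English description precedes it below -/
import Mathlib

section
/- Let d ≥ 1 and let μ be a probability distribution on the subsets of {1,…,n} with μ(S) = 0 unless |S| = d, whose generating polynomial g_μ = Σ_S μ(S)·∏_{i∈S} x_i is strongly log-concave at 𝟙. For η ⊆ {1,…,n} put w(η) = Σ_{ρ ∈ supp(μ), ρ ⊇ η} μ(ρ), and let P_μ be the real matrix indexed by supp(μ) with entries P_μ(τ,τ) = Σ_{i∈τ} μ(τ)/(d·w(τ∖{i})), P_μ(τ,σ) = μ(σ)/(d·w(τ∩σ)) when τ ≠ σ and |τ∩σ| = d−1, and 0 otherwise. Let X(k) = {η ⊆ {1,…,n} : |η| = k and η ⊆ S for some S ∈ supp(μ)}. Then the matrix Q_μ = diag(μ)^{1/2}·P_μ·diag(μ)^{−1/2} (indexed by supp(μ)) is symmetric, and for every 0 ≤ k ≤ d−1 it has at most |X(k)| (which is at most binomial(n,k)) eigenvalues, counted with multiplicity, strictly greater than 1 − (k+1)/d. In particular its second largest eigenvalue is at most 1 − 1/d. -/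
open MvPolynomial Matrix Finset
open scoped Classical

noncomputable section

abbrev MP (n : ℕ) := MvPolynomial (Fin n) ℝ

/-- Iterated partial derivative along a list of indices. -/
def derivList {n : ℕ} (l : List (Fin n)) (q : MP n) : MP n :=
  l.foldr (fun i r => pderiv i r) q

/-- Gradient at the all-ones point. -/
def gradOne {n : ℕ} (q : MP n) : Fin n → ℝ := fun i => eval (fun _ => (1:ℝ)) (pderiv i q)

/-- Hessian at the all-ones point. -/
def hessOne {n : ℕ} (q : MP n) : Matrix (Fin n) (Fin n) ℝ :=
  Matrix.of fun i j => eval (fun _ => (1:ℝ)) (pderiv i (pderiv j q))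

/-- `q` is log-concave at the all-ones point: `q(𝟙)·∇²q(𝟙) − ∇q(𝟙)∇q(𝟙)ᵀ` is NSD,
equivalently its negation is PSD. -/
def LogConcaveAtOne {n : ℕ} (q : MP n) : Prop :=
  (vecMulVec (gradOne q) (gradOne q) - eval (fun _ => (1:ℝ)) q • hessOne q).PosSemidef

/-- `q` is strongly log-concave at the all-ones point. -/
def StronglyLogConcaveAtOne {n : ℕ} (q : MP n) : Prop :=
  ∀ l : List (Fin n), LogConcaveAtOne (derivList l q)

/-- The generating polynomial `g_μ = Σ_S μ(S) ∏_{i∈S} x_i`. -/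
def genPoly (n : ℕ) (μ : Finset (Fin n) → ℝ) : MP n :=
  ∑ S : Finset (Fin n), C (μ S) * ∏ i ∈ S, X i

/-- `w(η) = Σ_{ρ ∈ supp μ, ρ ⊇ η} μ(ρ)`. -/
def wFun (n : ℕ) (μ : Finset (Fin n) → ℝ) (η : Finset (Fin n)) : ℝ :=
  ∑ ρ ∈ Finset.univ.filter (fun ρ : Finset (Fin n) => 0 < μ ρ ∧ η ⊆ ρ), μ ρ

/-- The support of `μ`, as a type. -/
abbrev Supp (n : ℕ) (μ : Finset (Fin n) → ℝ) := {S : Finset (Fin n) // 0 < μ S}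

/-- The transition probability matrix `P_μ` of the down-up walk `ℳ_μ`. -/
def Pmat (n d : ℕ) (μ : Finset (Fin n) → ℝ) : Matrix (Supp n μ) (Supp n μ) ℝ :=
  Matrix.of fun τ σ =>
    if τ = σ then ∑ i ∈ τ.1, μ τ.1 / (d * wFun n μ (τ.1.erase i))
    else if (τ.1 ∩ σ.1).card = d - 1 then μ σ.1 / (d * wFun n μ (τ.1 ∩ σ.1))
    else 0

/-- The symmetrized matrix `Q_μ = diag(μ)^{1/2} P_μ diag(μ)^{-1/2}`. -/
def Qmat (n d : ℕ) (μ : Finset (Fin n) → ℝ) : Matrix (Supp n μ) (Supp n μ) ℝ :=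
  Matrix.of fun τ σ => Real.sqrt (μ τ.1) * Pmat n d μ τ σ / Real.sqrt (μ σ.1)

/-- `X(k)`: size-`k` subsets contained in some element of the support of `μ`. -/
def Xk (n : ℕ) (μ : Finset (Fin n) → ℝ) (k : ℕ) : Finset (Finset (Fin n)) :=
  Finset.univ.filter (fun η : Finset (Fin n) => η.card = k ∧ ∃ S, 0 < μ S ∧ η ⊆ S)

def GG {n : ℕ} (ν : Finset (Fin n) → ℝ) (η : Finset (Fin n)) : ℝ :=
  ∑ ρ : Finset (Fin n), if η ⊆ ρ then ν ρ else 0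

lemma wFun_eq {n : ℕ} (μ : Finset (Fin n) → ℝ) (hnn : ∀ S, 0 ≤ μ S) (η : Finset (Fin n)) :
    wFun n μ η = GG μ η := by
  unfold wFun GG
  rw [Finset.sum_filter]
  refine Finset.sum_congr rfl fun ρ _ => ?_
  by_cases h : η ⊆ ρ
  · by_cases h2 : 0 < μ ρ
    · simp [h, h2]
    · have : μ ρ = 0 := le_antisymm (not_lt.mp h2) (hnn ρ)
      simp [this]
  · simp [h]

lemma GG_nonneg {n : ℕ} {μ : Finset (Fin n) → ℝ} (hnn : ∀ S, 0 ≤ μ S) (η : Finset (Fin n)) :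
    0 ≤ GG μ η := by
  refine Finset.sum_nonneg fun ρ _ => ?_
  split_ifs
  · exact hnn ρ
  · exact le_rfl

lemma pderiv_prod {n : ℕ} (i : Fin n) (S : Finset (Fin n)) :
    pderiv i (∏ j ∈ S, X j : MP n) = if i ∈ S then ∏ j ∈ S.erase i, X j else 0 := by
  have key : ∀ S : Finset (Fin n), i ∉ S → pderiv i (∏ j ∈ S, X j : MP n) = 0 := by
    intro S
    induction S using Finset.induction_on with
    | empty => intro _; simp
    | insert a S ha ih =>
      intro h
      rw [Finset.prod_insert ha, pderiv_mul]
      have h1 : i ≠ a := fun e => h (by simp [e])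
      have h2 : i ∉ S := fun e => h (by simp [e])
      rw [ih h2, pderiv_X_of_ne h1.symm]
      simp
  split_ifs with h
  · conv_lhs => rw [← Finset.mul_prod_erase S _ h]
    rw [pderiv_mul, key _ (Finset.notMem_erase i S)]
    simp
  · exact key S h

lemma derivList_prod {n : ℕ} (l : List (Fin n)) (S : Finset (Fin n)) :
    derivList l (∏ j ∈ S, X j : MP n) =
      if l.Nodup ∧ l.toFinset ⊆ S then ∏ j ∈ S \ l.toFinset, X j else 0 := by
  induction l with
  | nil => simp [derivList]
  | cons a l ih =>
    have : derivList (a :: l) (∏ j ∈ S, X j : MP n) =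
      pderiv a (derivList l (∏ j ∈ S, X j : MP n)) := rfl
    rw [this, ih]
    by_cases h : l.Nodup ∧ l.toFinset ⊆ S
    · rw [if_pos h, pderiv_prod]
      have : (S \ l.toFinset).erase a = S \ (a :: l).toFinset := by
        ext x; simp; tauto
      rw [this]
      congr 1
      simp only [List.nodup_cons, List.toFinset_cons, Finset.insert_subset_iff, mem_sdiff,
        List.mem_toFinset]
      apply propext; tauto
    · rw [if_neg h, if_neg]
      · simp
      · simp only [List.nodup_cons, List.toFinset_cons, Finset.insert_subset_iff]; tauto

lemma derivList_lin {n : ℕ} (l : List (Fin n)) (μ : Finset (Fin n) → ℝ) :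
    derivList l (genPoly n μ) = ∑ S, C (μ S) * derivList l (∏ j ∈ S, X j) := by
  induction l with
  | nil => rfl
  | cons a l ih =>
    have : derivList (a :: l) (genPoly n μ) = pderiv a (derivList l (genPoly n μ)) := rfl
    rw [this, ih, map_sum]
    refine Finset.sum_congr rfl fun S _ => ?_
    rw [pderiv_C_mul]; rfl

lemma eval_derivList {n : ℕ} (l : List (Fin n)) (μ : Finset (Fin n) → ℝ) :
    eval (fun _ => (1:ℝ)) (derivList l (genPoly n μ)) =
      if l.Nodup then GG μ l.toFinset else 0 := by
  rw [derivList_lin]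
  simp only [derivList_prod, map_sum, map_mul, eval_C]
  unfold GG
  by_cases h : l.Nodup
  · simp only [h, true_and, if_true]
    refine Finset.sum_congr rfl fun S _ => ?_
    split_ifs <;> simp
  · simp [h]

lemma lc_form {n : ℕ} {μ : Finset (Fin n) → ℝ} (hslc : StronglyLogConcaveAtOne (genPoly n μ))
    (η : Finset (Fin n)) (v : Fin n → ℝ) :
    GG μ η * ∑ i ∈ ηᶜ, ∑ j ∈ (insert i η)ᶜ, GG μ (insert j (insert i η)) * (v i * v j) ≤
      (∑ i ∈ ηᶜ, GG μ (insert i η) * v i) ^ 2 := by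
  have h := (hslc η.toList).dotProduct_mulVec_nonneg v
  have hg : ∀ i, gradOne (derivList η.toList (genPoly n μ)) i =
      if i ∈ ηᶜ then GG μ (insert i η) else 0 := by
    intro i
    have := eval_derivList (i :: η.toList) μ
    simp only [List.nodup_cons, List.toFinset_cons, Finset.toList_toFinset, Finset.mem_toList,
      Finset.nodup_toList, and_true] at this
    simpa [gradOne, derivList] using this
  have hh : ∀ i j, hessOne (derivList η.toList (genPoly n μ)) i j =
      if i ∈ ηᶜ then if j ∈ (insert i η)ᶜ then GG μ (insert j (insert i η)) else 0 else 0 := by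
    intro i j
    have := eval_derivList (i :: j :: η.toList) μ
    simp only [List.nodup_cons, List.toFinset_cons, Finset.toList_toFinset, Finset.mem_toList,
      Finset.nodup_toList, and_true, List.mem_cons] at this
    rw [Finset.insert_comm j i]
    have e : hessOne (derivList η.toList (genPoly n μ)) i j =
      eval (fun _ => (1:ℝ)) (derivList (i :: j :: η.toList) (genPoly n μ)) := rfl
    rw [e, this]
    by_cases h1 : i ∈ η <;> by_cases h2 : j ∈ η <;> by_cases h3 : i = j <;> simp_all [eq_comm]
  have he : eval (fun _ => (1:ℝ)) (derivList η.toList (genPoly n μ)) = GG μ η := by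
    rw [eval_derivList]; simp [Finset.nodup_toList]
  rw [Matrix.sub_mulVec, dotProduct_sub, Matrix.smul_mulVec, dotProduct_smul, he] at h
  have e1 : star v ⬝ᵥ (vecMulVec (gradOne (derivList η.toList (genPoly n μ)))
      (gradOne (derivList η.toList (genPoly n μ)))) *ᵥ v =
      (∑ i ∈ ηᶜ, GG μ (insert i η) * v i) ^ 2 := by
    have : (∑ i ∈ ηᶜ, GG μ (insert i η) * v i) =
        ∑ i, gradOne (derivList η.toList (genPoly n μ)) i * v i := by
      simp only [hg, ite_mul, zero_mul, Finset.sum_ite_mem, Finset.univ_inter]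
    rw [this, sq, Finset.sum_mul_sum]
    simp only [dotProduct, mulVec, vecMulVec_apply, Finset.mul_sum, Pi.star_apply, star_trivial]
    refine Finset.sum_congr rfl fun i _ => Finset.sum_congr rfl fun j _ => by ring
  have e2 : star v ⬝ᵥ (hessOne (derivList η.toList (genPoly n μ))) *ᵥ v =
      ∑ i ∈ ηᶜ, ∑ j ∈ (insert i η)ᶜ, GG μ (insert j (insert i η)) * (v i * v j) := by
    simp only [dotProduct, mulVec, Finset.mul_sum, Pi.star_apply, star_trivial]
    rw [← Finset.sum_subset (Finset.subset_univ ηᶜ)]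
    · refine Finset.sum_congr rfl fun i hi => ?_
      rw [← Finset.sum_subset (Finset.subset_univ (insert i η)ᶜ)]
      · refine Finset.sum_congr rfl fun j hj => ?_
        rw [hh, if_pos hi, if_pos hj]; ring
      · intro j _ hj
        rw [hh, if_neg hj]; simp
    · intro i _ hi
      simp [hh, hi]
  rw [e1, e2, smul_eq_mul] at h
  linarith

lemma swap_sum {n : ℕ} (m : ℕ) (φ : Finset (Fin n) → Fin n → ℝ) :
    ∑ ρ ∈ powersetCard (m+1) univ, ∑ i ∈ ρ, φ ρ i =
      ∑ η ∈ powersetCard m univ, ∑ i ∈ ηᶜ, φ (insert i η) i := by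
  rw [Finset.sum_sigma', Finset.sum_sigma']
  refine Finset.sum_bij' (fun p _ => ⟨p.1.erase p.2, p.2⟩) (fun p _ => ⟨insert p.2 p.1, p.2⟩)
    ?_ ?_ ?_ ?_ ?_
  · rintro ⟨ρ, i⟩ h
    simp [mem_powersetCard] at h ⊢
    rw [Finset.card_erase_of_mem h.2]; omega
  · rintro ⟨ρ, i⟩ h
    simp [mem_powersetCard] at h ⊢
    rw [Finset.card_insert_of_notMem h.2]; omega
  · rintro ⟨ρ, i⟩ h
    simp [mem_powersetCard] at h ⊢
    rw [Finset.insert_erase h.2]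
  · rintro ⟨ρ, i⟩ h
    simp [mem_powersetCard] at h ⊢
    exact h.2
  · rintro ⟨ρ, i⟩ h
    simp [mem_powersetCard] at h ⊢
    rw [Finset.insert_erase h.2]

lemma GG_up {n d m : ℕ} {ν : Finset (Fin n) → ℝ} (hhom : ∀ S, ν S ≠ 0 → S.card = d)
    (η : Finset (Fin n)) (hη : η.card = m) :
    ∑ i ∈ ηᶜ, GG ν (insert i η) = ((d:ℝ) - m) * GG ν η := by
  unfold GG
  rw [Finset.sum_comm, Finset.mul_sum]
  refine Finset.sum_congr rfl fun ρ _ => ?_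
  by_cases h0 : ν ρ = 0
  · simp [h0]
  by_cases h : η ⊆ ρ
  · simp only [Finset.insert_subset_iff, h, and_true, if_true]
    rw [Finset.sum_ite_mem, Finset.sum_const, nsmul_eq_mul]
    have : ηᶜ ∩ ρ = ρ \ η := by ext x; simp; tauto
    rw [this, Finset.card_sdiff_of_subset h, hhom ρ h0, hη, Nat.cast_sub]
    rw [← hhom ρ h0, ← hη]; exact Finset.card_le_card h
  · simp [Finset.insert_subset_iff, h]

lemma GG_zero {n : ℕ} {μ ν : Finset (Fin n) → ℝ} (hnn : ∀ S, 0 ≤ μ S)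
    (hν : ∀ S, μ S = 0 → ν S = 0) (η : Finset (Fin n)) (h : GG μ η = 0) : GG ν η = 0 := by
  unfold GG at *
  rw [Finset.sum_eq_zero_iff_of_nonneg] at h
  · refine Finset.sum_eq_zero fun ρ _ => ?_
    have := h ρ (Finset.mem_univ _)
    split_ifs at * with h1
    · exact hν _ this
    · rfl
  · intro ρ _
    split_ifs
    · exact hnn ρ
    · exact le_rfl

lemma GG_mono {n : ℕ} {μ : Finset (Fin n) → ℝ} (hnn : ∀ S, 0 ≤ μ S)
    {η ξ : Finset (Fin n)} (h : η ⊆ ξ) : GG μ ξ ≤ GG μ η := by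
  refine Finset.sum_le_sum fun ρ _ => ?_
  by_cases h1 : ξ ⊆ ρ
  · simp [h1, h.trans h1]
  · rw [if_neg h1]
    split_ifs
    · exact hnn ρ
    · exact le_rfl

def hh {n : ℕ} (μ ν : Finset (Fin n) → ℝ) (η : Finset (Fin n)) : ℝ := GG ν η / GG μ η

lemma GG_mul_hh {n : ℕ} {μ ν : Finset (Fin n) → ℝ} (hnn : ∀ S, 0 ≤ μ S)
    (hν : ∀ S, μ S = 0 → ν S = 0) (η : Finset (Fin n)) : GG μ η * hh μ ν η = GG ν η := by
  unfold hh
  by_cases h : GG μ η = 0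
  · rw [GG_zero hnn hν η h, h]; simp
  · field_simp

def AA {n : ℕ} (μ ν : Finset (Fin n) → ℝ) (m : ℕ) : ℝ :=
  ∑ η ∈ powersetCard m univ, GG μ η * hh μ ν η ^ 2

lemma AA_nonneg {n : ℕ} {μ : Finset (Fin n) → ℝ} (hnn : ∀ S, 0 ≤ μ S)
    (ν : Finset (Fin n) → ℝ) (m : ℕ) : 0 ≤ AA μ ν m :=
  Finset.sum_nonneg fun η _ => mul_nonneg (GG_nonneg hnn η) (sq_nonneg _)

lemma local_ineq {n d m : ℕ} {μ ν : Finset (Fin n) → ℝ} (hnn : ∀ S, 0 ≤ μ S)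
    (hhom : ∀ S, μ S ≠ 0 → S.card = d)
    (hν : ∀ S, μ S = 0 → ν S = 0)
    (hslc : StronglyLogConcaveAtOne (genPoly n μ)) (η : Finset (Fin n)) (hη : η.card = m) :
    ∑ i ∈ ηᶜ, ∑ j ∈ (insert i η)ᶜ, GG μ (insert j (insert i η)) *
      (hh μ ν (insert i η) * hh μ ν (insert j η)) ≤
      ((d:ℝ) - m) * (d - m - 1) * (GG μ η * hh μ ν η ^ 2) := by
  have hhomν : ∀ S, ν S ≠ 0 → S.card = d := fun S hS => hhom S fun h => hS (hν S h)
  by_cases hW : GG μ η = 0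
  · rw [hW, Finset.sum_eq_zero]
    · simp
    · intro i _
      refine Finset.sum_eq_zero fun j _ => ?_
      have : GG μ (insert j (insert i η)) = 0 := by
        refine le_antisymm ?_ (GG_nonneg hnn _)
        rw [← hW]
        exact GG_mono hnn ((Finset.subset_insert _ _).trans (Finset.subset_insert _ _))
      simp [this]
  have hWp : 0 < GG μ η := lt_of_le_of_ne (GG_nonneg hnn η) (Ne.symm hW)
  set c := hh μ ν η with hc
  have key := lc_form hslc η (fun i => hh μ ν (insert i η) - c)
  have hcard : ∀ i ∈ ηᶜ, (insert i η).card = m + 1 := by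
    intro i hi
    rw [Finset.card_insert_of_notMem (by simpa using hi), hη]
  have s0 : ∑ i ∈ ηᶜ, GG μ (insert i η) * hh μ ν (insert i η) = ((d:ℝ) - m) * (GG μ η * c) := by
    simp only [GG_mul_hh hnn hν, hc]
    exact GG_up hhomν η hη
  have r0 : ∑ i ∈ ηᶜ, GG μ (insert i η) * (hh μ ν (insert i η) - c) = 0 := by
    simp only [mul_sub, Finset.sum_sub_distrib]
    rw [s0, ← Finset.sum_mul, GG_up hhom η hη]; ring
  rw [r0] at key
  have up2 : ∀ i ∈ ηᶜ, ∑ j ∈ (insert i η)ᶜ, GG μ (insert j (insert i η)) =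
      ((d:ℝ) - m - 1) * GG μ (insert i η) := by
    intro i hi
    rw [GG_up hhom _ (hcard i hi)]; push_cast; ring
  have s1 : ∑ i ∈ ηᶜ, ∑ j ∈ (insert i η)ᶜ, GG μ (insert j (insert i η)) * hh μ ν (insert i η) =
      ((d:ℝ) - m) * (d - m - 1) * (GG μ η * c) := by
    rw [show ((d:ℝ) - m) * (d - m - 1) * (GG μ η * c) =
      (d - m - 1) * (((d:ℝ) - m) * (GG μ η * c)) by ring, ← s0, Finset.mul_sum]
    refine Finset.sum_congr rfl fun i hi => ?_
    rw [← Finset.sum_mul, up2 i hi]; ring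
  have s2 : ∑ i ∈ ηᶜ, ∑ j ∈ (insert i η)ᶜ, GG μ (insert j (insert i η)) * hh μ ν (insert j η) =
      ((d:ℝ) - m) * (d - m - 1) * (GG μ η * c) := by
    rw [← s1]
    rw [Finset.sum_comm' (t' := ηᶜ) (s' := fun j => (insert j η)ᶜ)]
    · refine Finset.sum_congr rfl fun i hi => Finset.sum_congr rfl fun j hj => ?_
      rw [Finset.insert_comm]
    · intro x y
      simp only [mem_compl, mem_insert, not_or]
      constructor
      · rintro ⟨a, b, e⟩; exact ⟨⟨fun h => b h.symm, a⟩, e⟩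
      · rintro ⟨⟨b, a⟩, e⟩; exact ⟨a, fun h => b h.symm, e⟩
  have s3 : ∑ i ∈ ηᶜ, ∑ j ∈ (insert i η)ᶜ, GG μ (insert j (insert i η)) =
      ((d:ℝ) - m) * (d - m - 1) * GG μ η := by
    rw [Finset.sum_congr rfl up2, ← Finset.mul_sum, GG_up hhom η hη]; ring
  have ex : ∑ i ∈ ηᶜ, ∑ j ∈ (insert i η)ᶜ, GG μ (insert j (insert i η)) *
      ((hh μ ν (insert i η) - c) * (hh μ ν (insert j η) - c)) =
      ∑ i ∈ ηᶜ, ∑ j ∈ (insert i η)ᶜ, GG μ (insert j (insert i η)) *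
      (hh μ ν (insert i η) * hh μ ν (insert j η)) -
      c * (((d:ℝ) - m) * (d - m - 1) * (GG μ η * c)) -
      c * (((d:ℝ) - m) * (d - m - 1) * (GG μ η * c)) +
      c ^ 2 * (((d:ℝ) - m) * (d - m - 1) * GG μ η) := by
    nth_rewrite 1 [← s1]
    rw [← s2, ← s3]
    simp only [Finset.mul_sum, ← Finset.sum_sub_distrib, ← Finset.sum_add_distrib]
    refine Finset.sum_congr rfl fun i hi => Finset.sum_congr rfl fun j hj => ?_
    ring
  simp only [ex] at key
  have key2 := nonpos_of_mul_nonpos_right (by simpa using key) hWp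
  nlinarith [key2]

lemma B_ineq {n d m : ℕ} {μ ν : Finset (Fin n) → ℝ} (hnn : ∀ S, 0 ≤ μ S)
    (hhom : ∀ S, μ S ≠ 0 → S.card = d)
    (hν : ∀ S, μ S = 0 → ν S = 0)
    (hslc : StronglyLogConcaveAtOne (genPoly n μ)) :
    ∑ ρ ∈ powersetCard (m+1+1) univ, GG μ ρ * (∑ i ∈ ρ, hh μ ν (ρ.erase i)) ^ 2 ≤
      ((d:ℝ) - m) * (d - m - 1) * AA μ ν m + (d - m - 1) * AA μ ν (m+1) := by
  have e : ∀ ρ : Finset (Fin n), GG μ ρ * (∑ i ∈ ρ, hh μ ν (ρ.erase i)) ^ 2 =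
      ∑ i ∈ ρ, (∑ j ∈ ρ.erase i, GG μ ρ * (hh μ ν (ρ.erase i) * hh μ ν (ρ.erase j))) +
      ∑ i ∈ ρ, GG μ ρ * hh μ ν (ρ.erase i) ^ 2 := by
    intro ρ
    rw [sq, Finset.sum_mul_sum, Finset.mul_sum, ← Finset.sum_add_distrib]
    refine Finset.sum_congr rfl fun i hi => ?_
    rw [← Finset.add_sum_erase ρ _ hi, mul_add, Finset.mul_sum]; ring
  simp only [e]
  rw [Finset.sum_add_distrib]
  refine add_le_add ?_ (le_of_eq ?_)
  · rw [swap_sum]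
    have : ∑ ξ ∈ powersetCard (m+1) (univ : Finset (Fin n)), ∑ i ∈ ξᶜ,
        ∑ j ∈ (insert i ξ).erase i, GG μ (insert i ξ) * (hh μ ν ((insert i ξ).erase i) *
          hh μ ν ((insert i ξ).erase j)) =
        ∑ ξ ∈ powersetCard (m+1) (univ : Finset (Fin n)), ∑ j ∈ ξ, ∑ i ∈ ξᶜ,
          GG μ (insert i ξ) * (hh μ ν ξ * hh μ ν ((insert i ξ).erase j)) := by
      refine Finset.sum_congr rfl fun ξ _ => ?_
      rw [Finset.sum_comm]
      refine Finset.sum_congr rfl fun i hi => ?_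
      rw [Finset.erase_insert (by simpa using hi)]
    rw [this, swap_sum, AA, Finset.mul_sum]
    refine Finset.sum_le_sum fun η hη => ?_
    refine le_trans (le_of_eq ?_) (local_ineq hnn hhom hν hslc η (by simpa using hη))
    refine Finset.sum_congr rfl fun i hi => Finset.sum_congr rfl fun j hj => ?_
    rw [Finset.insert_comm j i, Finset.erase_insert]
    simp at hi hj ⊢
    exact ⟨fun h => hj.1 h.symm, hi⟩
  · rw [swap_sum, AA, Finset.mul_sum]
    refine Finset.sum_congr rfl fun η hη => ?_
    have hη' : η.card = m + 1 := by simpa using hη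
    have := GG_up hhom η hη'
    push_cast at this
    rw [show ((d:ℝ) - m - 1) * (GG μ η * hh μ ν η ^ 2) =
      ((d:ℝ) - (m + 1)) * GG μ η * hh μ ν η ^ 2 by ring, ← this, Finset.sum_mul]
    refine Finset.sum_congr rfl fun i hi => ?_
    rw [Finset.erase_insert (by simpa using hi)]

lemma CS_step {n d m : ℕ} {μ ν : Finset (Fin n) → ℝ} (hnn : ∀ S, 0 ≤ μ S)
    (hhom : ∀ S, μ S ≠ 0 → S.card = d)
    (hν : ∀ S, μ S = 0 → ν S = 0) :
    (((d:ℝ) - m) * AA μ ν m) ^ 2 ≤ AA μ ν (m+1) *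
    ∑ ρ ∈ powersetCard (m+1) univ, GG μ ρ * (∑ i ∈ ρ, hh μ ν (ρ.erase i)) ^ 2 := by
  have hhomν : ∀ S, ν S ≠ 0 → S.card = d := fun S hS => hhom S fun h => hS (hν S h)
  have e : ((d:ℝ) - m) * AA μ ν m = ∑ ρ ∈ powersetCard (m+1) (univ : Finset (Fin n)),
      (GG μ ρ * hh μ ν ρ) * (∑ i ∈ ρ, hh μ ν (ρ.erase i)) := by
    simp only [Finset.mul_sum]
    rw [swap_sum, AA, Finset.mul_sum]
    refine Finset.sum_congr rfl fun η hη => ?_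
    have hη' : η.card = m := by simpa using hη
    have := GG_up hhomν η hη'
    rw [show ((d:ℝ) - m) * (GG μ η * hh μ ν η ^ 2) =
      (((d:ℝ) - m) * (GG μ η * hh μ ν η)) * hh μ ν η by ring, GG_mul_hh hnn hν, ← this,
      Finset.sum_mul]
    refine Finset.sum_congr rfl fun i hi => ?_
    rw [Finset.erase_insert (by simpa using hi), GG_mul_hh hnn hν]
  rw [e, AA]
  have := Finset.sum_mul_sq_le_sq_mul_sq (powersetCard (m+1) (univ : Finset (Fin n)))
    (fun ρ => √(GG μ ρ) * hh μ ν ρ) (fun ρ => √(GG μ ρ) * (∑ i ∈ ρ, hh μ ν (ρ.erase i)))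
  simp only [mul_pow, Real.sq_sqrt (GG_nonneg hnn _)] at this
  refine le_trans (le_of_eq ?_) this
  congr 1
  refine Finset.sum_congr rfl fun ρ _ => ?_
  nth_rewrite 1 [← Real.mul_self_sqrt (GG_nonneg hnn ρ)]
  ring

lemma main_ineq {n d k : ℕ} {μ ν : Finset (Fin n) → ℝ} (hnn : ∀ S, 0 ≤ μ S)
    (hhom : ∀ S, μ S ≠ 0 → S.card = d)
    (hν : ∀ S, μ S = 0 → ν S = 0)
    (hslc : StronglyLogConcaveAtOne (genPoly n μ))
    (hk : ∀ η : Finset (Fin n), η.card = k → GG ν η = 0) (t : ℕ) (ht : k + t < d) :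
    ((d:ℝ) - (k + t)) * AA μ ν (k+t) ≤ t * AA μ ν (k+t+1) := by
  induction t with
  | zero =>
    have : AA μ ν k = 0 := by
      refine Finset.sum_eq_zero fun η hη => ?_
      rw [hh, hk η (by simpa using hη)]; simp
    simp [this]
  | succ t ih =>
    have ih := ih (by omega)
    have hB := B_ineq (m := k + t) hnn hhom hν hslc
    have hC := CS_step (m := k + t + 1) hnn hhom hν
    have hp : (0:ℝ) < d - (k + t + 1) := by
      have : ((k + (t + 1) : ℕ) : ℝ) < d := by exact_mod_cast ht
      push_cast at this; linarith
    have h1 := AA_nonneg hnn ν (k+t+1)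
    have h2 := AA_nonneg hnn ν (k+t+1+1)
    rw [show k + (t + 1) = k + t + 1 by ring]
    push_cast at *
    set a := AA μ ν (k+t+1)
    set b := AA μ ν (k+t+1+1)
    set B := ∑ ρ ∈ powersetCard (k+t+1+1) univ, GG μ ρ * (∑ i ∈ ρ, hh μ ν (ρ.erase i)) ^ 2
    set p : ℝ := d - (k + t + 1) with hpdef
    have hB' : B ≤ p * (t + 1) * a := by
      have := mul_le_mul_of_nonneg_left ih hp.le
      rw [hpdef] at this ⊢
      nlinarith
    rw [show (d:ℝ) - (k + (t + 1)) = p by rw [hpdef]; ring]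
    rcases h1.eq_or_lt with h0 | h0
    · rw [← h0]; simp; positivity
    · have h3 : (p * a) ^ 2 ≤ b * (p * (t + 1) * a) :=
        hC.trans (mul_le_mul_of_nonneg_left hB' h2)
      have h4 : (p * a) * (p * a) ≤ (p * a) * ((t + 1) * b) := by nlinarith
      exact le_of_mul_le_mul_left h4 (by positivity)

lemma count_eig {ι κ : Type} [Fintype ι] [Fintype κ] (A : Matrix ι ι ℝ)
    (hA : A.IsHermitian) (t : ℝ) (L : (ι → ℝ) →ₗ[ℝ] (κ → ℝ))
    (h : ∀ x, L x = 0 → x ⬝ᵥ A *ᵥ x ≤ t * (x ⬝ᵥ x)) :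
    (Finset.univ.filter fun i => t < hA.eigenvalues i).card ≤ Fintype.card κ := by
  by_contra hc
  push Not at hc
  set s := Finset.univ.filter fun i => t < hA.eigenvalues i with hs
  let u : ι → ι → ℝ := fun i => WithLp.ofLp (hA.eigenvectorBasis i)
  have hu : ∀ i j, u i ⬝ᵥ u j = if i = j then 1 else 0 := by
    intro i j
    have := (orthonormal_iff_ite.mp hA.eigenvectorBasis.orthonormal) j i
    rw [EuclideanSpace.inner_eq_star_dotProduct] at this
    simpa [u, eq_comm] using this
  have hAu : ∀ i, A *ᵥ u i = hA.eigenvalues i • u i := hA.mulVec_eigenvectorBasis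
  let T : (s → ℝ) →ₗ[ℝ] (ι → ℝ) :=
    { toFun := fun c => ∑ i : s, c i • u i
      map_add' := by intro a b; simp [add_smul, Finset.sum_add_distrib]
      map_smul' := by intro a b; simp [mul_smul, Finset.smul_sum] }
  have hker : LinearMap.ker (L ∘ₗ T) ≠ ⊥ := by
    apply LinearMap.ker_ne_bot_of_finrank_lt
    simpa using hc
  obtain ⟨c, hcm, hc0⟩ := Submodule.exists_mem_ne_zero_of_ne_bot hker
  have hx := h (T c) hcm
  have hT : T c = ∑ i : s, c i • u i := rfl
  have e1 : T c ⬝ᵥ T c = ∑ i : s, c i ^ 2 := by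
    rw [hT]
    simp only [sum_dotProduct, dotProduct_sum,
      smul_dotProduct, dotProduct_smul, hu, smul_eq_mul]
    refine Finset.sum_congr rfl fun i _ => ?_
    rw [Finset.sum_eq_single i]
    · simp; ring
    · intro j _ hj
      simp [hj]
    · simp
  have e2 : T c ⬝ᵥ A *ᵥ T c = ∑ i : s, hA.eigenvalues i * c i ^ 2 := by
    rw [hT]
    simp only [Matrix.mulVec_sum, Matrix.mulVec_smul, hAu,
      sum_dotProduct, dotProduct_sum, smul_dotProduct, dotProduct_smul, hu, smul_eq_mul]
    refine Finset.sum_congr rfl fun i _ => ?_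
    rw [Finset.sum_eq_single i]
    · simp; ring
    · intro j _ hj
      simp [hj]
    · simp
  rw [e1, e2, Finset.mul_sum] at hx
  refine absurd hx (not_le.mpr ?_)
  obtain ⟨i, hi⟩ := Function.ne_iff.mp hc0
  have hl : ∀ j : s, t < hA.eigenvalues j := fun j => (Finset.mem_filter.mp j.2).2
  refine Finset.sum_lt_sum (fun j _ => mul_le_mul_of_nonneg_right (hl j).le (sq_nonneg _))
    ⟨i, Finset.mem_univ _, mul_lt_mul_of_pos_right (hl i) ?_⟩
  have : c i ≠ 0 := hi
  positivity

lemma sum_supp {n : ℕ} (μ : Finset (Fin n) → ℝ) (g : Supp n μ → ℝ) :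
    ∑ S : Finset (Fin n), (if h : 0 < μ S then g ⟨S, h⟩ else 0) = ∑ τ : Supp n μ, g τ := by
  have := Finset.sum_subtype (Finset.univ.filter fun S => 0 < μ S) (p := fun S => 0 < μ S)
    (F := inferInstance)
    (by simp) (fun S => if h : 0 < μ S then g ⟨S, h⟩ else 0)
  rw [Finset.sum_filter] at this
  rw [show ∑ τ : Supp n μ, g τ = ∑ τ : Supp n μ,
    (if h : 0 < μ τ.1 then g ⟨τ.1, h⟩ else 0) from
      Finset.sum_congr rfl fun τ _ => by simp [τ.2]]
  rw [← this]
  refine Finset.sum_congr rfl fun S _ => ?_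
  split_ifs <;> rfl

lemma sum_erase_eq {n d : ℕ} (hd : 1 ≤ d) (τ : Finset (Fin n)) (hτ : τ.card = d)
    (f : Finset (Fin n) → ℝ) :
    ∑ η ∈ powersetCard (d-1) univ, (if η ⊆ τ then f η else 0) = ∑ i ∈ τ, f (τ.erase i) := by
  rw [← Finset.sum_filter, ← Finset.sum_image (g := fun i => τ.erase i) (f := f)
    (Finset.erase_injOn τ)]
  refine Finset.sum_congr ?_ fun _ _ => rfl
  ext η
  simp only [mem_filter, mem_powersetCard, subset_univ, true_and, mem_image]
  constructor
  · rintro ⟨h1, h2⟩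
    obtain ⟨a, ha, e⟩ := Finset.exists_eq_insert_iff.mpr ⟨h2, by omega⟩
    exact ⟨a, by simp [← e], by rw [← e, Finset.erase_insert ha]⟩
  · rintro ⟨a, ha, rfl⟩
    exact ⟨by rw [Finset.card_erase_of_mem ha, hτ], Finset.erase_subset _ _⟩

lemma Q_entry {n d : ℕ} (hd : 1 ≤ d) {μ : Finset (Fin n) → ℝ} (hnn : ∀ S, 0 ≤ μ S)
    (hhom : ∀ S, μ S ≠ 0 → S.card = d) (τ σ : Supp n μ) :
    Qmat n d μ τ σ = ∑ η ∈ powersetCard (d-1) univ,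
      (if η ⊆ τ.1 then √(μ τ.1) else 0) * (if η ⊆ σ.1 then √(μ σ.1) else 0) / (d * GG μ η) := by
  have hτ := hhom τ.1 τ.2.ne'
  have hσ := hhom σ.1 σ.2.ne'
  have pτ := Real.sqrt_pos.mpr τ.2
  have pσ := Real.sqrt_pos.mpr σ.2
  simp only [Qmat, Pmat, Matrix.of_apply, wFun_eq μ hnn]
  by_cases h : τ = σ
  · subst h
    rw [if_pos rfl, mul_div_right_comm, div_self pτ.ne', one_mul,
      ← sum_erase_eq hd τ.1 hτ (fun η => μ τ.1 / (d * GG μ η))]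
    refine Finset.sum_congr rfl fun η _ => ?_
    split_ifs
    · rw [Real.mul_self_sqrt (hnn _)]
    · simp
  · rw [if_neg h]
    have hne : τ.1 ≠ σ.1 := fun e => h (Subtype.ext e)
    have hlt : (τ.1 ∩ σ.1).card < d := by
      rw [← hτ]
      refine Finset.card_lt_card (Finset.ssubset_iff_subset_ne.mpr ⟨Finset.inter_subset_left, ?_⟩)
      intro e
      exact hne (Finset.eq_of_subset_of_card_le (Finset.inter_eq_left.mp e) (by omega))
    have hsub : ∀ η : Finset (Fin n), η.card = d - 1 → η ⊆ τ.1 → η ⊆ σ.1 → η = τ.1 ∩ σ.1 := by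
      intro η h1 h2 h3
      exact Finset.eq_of_subset_of_card_le (Finset.subset_inter h2 h3) (by omega)
    split_ifs with hc
    · rw [Finset.sum_eq_single (τ.1 ∩ σ.1)]
      · rw [if_pos Finset.inter_subset_left, if_pos Finset.inter_subset_right]
        nth_rewrite 1 [← Real.mul_self_sqrt (hnn σ.1)]
        field_simp
      · intro η hη hn
        have h1 : η.card = d - 1 := by simpa using hη
        by_cases h2 : η ⊆ τ.1
        · by_cases h3 : η ⊆ σ.1
          · exact absurd (hsub η h1 h2 h3) hn
          · simp [h3]
        · simp [h2]
      · intro hn; exact absurd (by simpa using hc) hn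
    · rw [Finset.sum_eq_zero]
      · simp
      · intro η hη
        have h1 : η.card = d - 1 := by simpa using hη
        by_cases h2 : η ⊆ τ.1
        · by_cases h3 : η ⊆ σ.1
          · exact absurd (hsub η h1 h2 h3 ▸ h1) hc
          · simp [h3]
        · simp [h2]

def nu {n : ℕ} (μ : Finset (Fin n) → ℝ) (x : Supp n μ → ℝ) (S : Finset (Fin n)) : ℝ :=
  if h : 0 < μ S then √(μ S) * x ⟨S, h⟩ else 0

lemma GG_nu {n : ℕ} (μ : Finset (Fin n) → ℝ) (x : Supp n μ → ℝ) (η : Finset (Fin n)) :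
    GG (nu μ x) η = ∑ τ : Supp n μ, (if η ⊆ τ.1 then √(μ τ.1) else 0) * x τ := by
  rw [← sum_supp]
  unfold GG nu
  refine Finset.sum_congr rfl fun S _ => ?_
  split_ifs <;> simp

lemma Q_form {n d : ℕ} (hd : 1 ≤ d) {μ : Finset (Fin n) → ℝ} (hnn : ∀ S, 0 ≤ μ S)
    (hhom : ∀ S, μ S ≠ 0 → S.card = d) (x : Supp n μ → ℝ) :
    x ⬝ᵥ Qmat n d μ *ᵥ x = AA μ (nu μ x) (d-1) / d := by
  simp only [dotProduct, mulVec, Q_entry hd hnn hhom, AA, hh, GG_nu]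
  rw [Finset.sum_div]
  have : ∀ η : Finset (Fin n), GG μ η * ((∑ τ : Supp n μ, (if η ⊆ τ.1 then √(μ τ.1) else 0) * x τ)
      / GG μ η) ^ 2 / d = ∑ τ : Supp n μ, ∑ σ : Supp n μ, x τ * (
      (if η ⊆ τ.1 then √(μ τ.1) else 0) * (if η ⊆ σ.1 then √(μ σ.1) else 0) / (d * GG μ η) * x σ) := by
    intro η
    have e : ∀ F : ℝ, GG μ η * (F / GG μ η) ^ 2 / d = F * F * (1 / (d * GG μ η)) := by
      intro F
      by_cases h : GG μ η = 0
      · simp [h]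
      · field_simp
    rw [e, Finset.sum_mul_sum, Finset.sum_mul]
    refine Finset.sum_congr rfl fun τ _ => ?_
    rw [Finset.sum_mul]
    refine Finset.sum_congr rfl fun σ _ => ?_
    ring
  simp only [this]
  rw [Finset.sum_comm]
  refine Finset.sum_congr rfl fun τ _ => ?_
  rw [Finset.sum_comm, Finset.mul_sum]
  refine Finset.sum_congr rfl fun σ _ => ?_
  rw [Finset.sum_mul, Finset.mul_sum]

lemma GG_top {n d : ℕ} {ν : Finset (Fin n) → ℝ}
    (hhom : ∀ S, ν S ≠ 0 → S.card = d) (η : Finset (Fin n)) (hη : η.card = d) : GG ν η = ν η := by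
  unfold GG
  rw [Finset.sum_eq_single η]
  · simp
  · intro ρ _ hne
    split_ifs with h
    · by_contra h0
      exact hne (Finset.eq_of_subset_of_card_le h (by rw [hhom ρ h0, hη])).symm
    · rfl
  · simp

lemma AA_top {n d : ℕ} {μ : Finset (Fin n) → ℝ} (hnn : ∀ S, 0 ≤ μ S)
    (hhom : ∀ S, μ S ≠ 0 → S.card = d) (x : Supp n μ → ℝ) :
    AA μ (nu μ x) d = x ⬝ᵥ x := by
  have hhomν : ∀ S, nu μ x S ≠ 0 → S.card = d := fun S hS => hhom S fun h => hS (by simp [nu, h])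
  rw [dotProduct, ← sum_supp μ (fun τ => x τ * x τ), AA]
  rw [← Finset.sum_subset (Finset.subset_univ (powersetCard d (univ : Finset (Fin n))))]
  · refine Finset.sum_congr rfl fun η hη => ?_
    have h1 : η.card = d := by simpa using hη
    rw [hh, GG_top hhom η h1, GG_top hhomν η h1, nu]
    split_ifs with h
    · rw [div_pow, mul_pow, Real.sq_sqrt h.le]
      field_simp
    · simp
  · intro S _ hS
    rw [dif_neg]
    intro h
    exact hS (by simpa using hhom S h.ne')

lemma Xk_le {n : ℕ} (μ : Finset (Fin n) → ℝ) (k : ℕ) : (Xk n μ k).card ≤ n.choose k := by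
  have : Xk n μ k ⊆ powersetCard k univ := by
    intro η hη
    simp [Xk] at hη ⊢
    exact hη.1
  simpa using Finset.card_le_card this

lemma count_main {n d : ℕ} (hd : 1 ≤ d) {μ : Finset (Fin n) → ℝ} (hnn : ∀ S, 0 ≤ μ S)
    (hhom : ∀ S, μ S ≠ 0 → S.card = d) (hslc : StronglyLogConcaveAtOne (genPoly n μ))
    (hQ : (Qmat n d μ).IsHermitian) (k : ℕ) (hk : k ≤ d - 1) :
    (Finset.univ.filter fun τ : Supp n μ =>
      1 - ((k : ℝ) + 1) / d < hQ.eigenvalues τ).card ≤ (Xk n μ k).card := by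
  let L : (Supp n μ → ℝ) →ₗ[ℝ] (Xk n μ k → ℝ) :=
    { toFun := fun x η => ∑ τ : Supp n μ, (if η.1 ⊆ τ.1 then √(μ τ.1) else 0) * x τ
      map_add' := by intro a b; ext η; simp [mul_add, Finset.sum_add_distrib]
      map_smul' := by
        intro a b; ext η
        simp only [Pi.smul_apply, smul_eq_mul, RingHom.id_apply, Finset.mul_sum]
        exact Finset.sum_congr rfl fun _ _ => by ring }
  have := count_eig (Qmat n d μ) hQ (1 - ((k : ℝ) + 1) / d) L ?_
  · rw [Fintype.card_coe] at this
    convert this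
  intro x hx
  have hz : ∀ η : Finset (Fin n), η.card = k → GG (nu μ x) η = 0 := by
    intro η hη
    rw [GG_nu]
    by_cases hm : η ∈ Xk n μ k
    · exact congrFun hx ⟨η, hm⟩
    · refine Finset.sum_eq_zero fun τ _ => ?_
      rw [if_neg]
      · simp
      · intro hs
        exact hm (by simp only [Xk, mem_filter, mem_univ, true_and]; exact ⟨hη, τ.1, τ.2, hs⟩)
  have hν : ∀ S, μ S = 0 → nu μ x S = 0 := fun S hS => by simp [nu, hS]
  obtain ⟨t, ht⟩ := Nat.exists_eq_add_of_le hk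
  have hm := main_ineq hnn hhom hν hslc hz t (by omega)
  have hdt : d = k + t + 1 := by omega
  rw [Q_form hd hnn hhom, ← AA_top hnn hhom x, ht]
  rw [show AA μ (nu μ x) d = AA μ (nu μ x) (k+t+1) by rw [← hdt]]
  have hdr : (d:ℝ) = k + t + 1 := by exact_mod_cast hdt
  have hdp : (0:ℝ) < d := by exact_mod_cast hd
  rw [div_le_iff₀ hdp]
  have e : (1 - ((k : ℝ) + 1) / d) * d = t := by
    field_simp; rw [hdr]; ring
  rw [mul_right_comm, e]
  rw [hdr] at hm
  linarith

theorem stmt0 (n d : ℕ) (hd : 1 ≤ d) (μ : Finset (Fin n) → ℝ)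
    (hnn : ∀ S, 0 ≤ μ S) (hsum : ∑ S : Finset (Fin n), μ S = 1)
    (hhom : ∀ S, μ S ≠ 0 → S.card = d)
    (hslc : StronglyLogConcaveAtOne (genPoly n μ)) :
    ∃ hQ : (Qmat n d μ).IsHermitian,
      (∀ k : ℕ, k ≤ d - 1 →
        ((Finset.univ.filter fun τ : Supp n μ =>
            1 - ((k : ℝ) + 1) / d < hQ.eigenvalues τ).card ≤ (Xk n μ k).card ∧
          (Xk n μ k).card ≤ n.choose k)) ∧
      (Finset.univ.filter fun τ : Supp n μ =>
          1 - 1 / (d : ℝ) < hQ.eigenvalues τ).card ≤ 1 := by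
  have hQ : (Qmat n d μ).IsHermitian := by
    ext τ σ
    rw [Matrix.conjTranspose_apply, star_trivial, Q_entry hd hnn hhom, Q_entry hd hnn hhom]
    exact Finset.sum_congr rfl fun η _ => by rw [mul_comm (ite _ _ _)]
  refine ⟨hQ, fun k hk => ⟨count_main hd hnn hhom hslc hQ k hk, Xk_le μ k⟩, ?_⟩
  have h0 := (count_main hd hnn hhom hslc hQ 0 (Nat.zero_le _)).trans (Xk_le μ 0)
  simpa using h0

end
end

section
/- Let f = Σ_{S ⊆ {1,…,n}, |S| = k} c_S·∏_{i∈S} x_i be a multiaffine k-homogeneous polynomial with nonnegative coefficients c_S ≥ 0 that is strongly log-concave at 𝟙, and let 0 ≤ α ≤ 1. Then the polynomial f_α = Σ_{S ⊆ {1,…,n}, |S| = k} c_S^{(α)}·∏_{i∈S} x_i is strongly log-concave at 𝟙, where c_S^{(α)} = c_S^α (real power) if c_S > 0 and c_S^{(α)} = 0 if c_S = 0. -/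
open MvPolynomial Matrix Finset
open scoped Classical

noncomputable section

/-- Reverse Cauchy-Schwarz property. -/
def Lor {ι : Type*} [Fintype ι] (H : Matrix ι ι ℝ) : Prop :=
  ∀ x : ι → ℝ, ((1 : ι → ℝ) ⬝ᵥ H *ᵥ 1) * (x ⬝ᵥ H *ᵥ x) ≤ ((1 : ι → ℝ) ⬝ᵥ H *ᵥ x) ^ 2

lemma bil_symm {ι : Type*} [Fintype ι] {G : Matrix ι ι ℝ} (hG : G.IsSymm) (x y : ι → ℝ) :
    x ⬝ᵥ G *ᵥ y = y ⬝ᵥ G *ᵥ x := by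
  rw [dotProduct_mulVec, dotProduct_comm, ← mulVec_transpose, hG.eq]

lemma bil_sub_smul {ι : Type*} [Fintype ι] {G : Matrix ι ι ℝ} (hG : G.IsSymm) (x w : ι → ℝ)
    (t : ℝ) : (x - t • w) ⬝ᵥ G *ᵥ (x - t • w) =
      x ⬝ᵥ G *ᵥ x - 2 * t * (w ⬝ᵥ G *ᵥ x) + t ^ 2 * (w ⬝ᵥ G *ᵥ w) := by
  simp only [mulVec_sub, dotProduct_sub, sub_dotProduct, mulVec_smul, smul_dotProduct,
    dotProduct_smul, smul_eq_mul]
  rw [bil_symm hG x w]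
  ring

lemma revCS {ι : Type*} [Fintype ι] {G : Matrix ι ι ℝ} (hG : G.IsSymm) (u : ι → ℝ)
    (h : ∀ y, u ⬝ᵥ y = 0 → y ⬝ᵥ G *ᵥ y ≤ 0) (w : ι → ℝ) (hw : 0 ≤ w ⬝ᵥ G *ᵥ w) (x : ι → ℝ) :
    (w ⬝ᵥ G *ᵥ w) * (x ⬝ᵥ G *ᵥ x) ≤ (w ⬝ᵥ G *ᵥ x) ^ 2 := by
  rcases hw.eq_or_lt with h0 | hpos
  · rw [← h0]; nlinarith [sq_nonneg (w ⬝ᵥ G *ᵥ x)]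
  have hu : u ⬝ᵥ w ≠ 0 := fun h0 => absurd (h w h0) (not_le.mpr hpos)
  have := h (x - (u ⬝ᵥ x / u ⬝ᵥ w) • w) (by
    rw [dotProduct_sub, dotProduct_smul, smul_eq_mul]; field_simp; ring)
  rw [bil_sub_smul hG] at this
  set t := u ⬝ᵥ x / u ⬝ᵥ w
  nlinarith [sq_nonneg (w ⬝ᵥ G *ᵥ x - t * (w ⬝ᵥ G *ᵥ w)), mul_le_mul_of_nonneg_left this hw]

lemma bil_eq {ι : Type*} [Fintype ι] (G : Matrix ι ι ℝ) (x y : ι → ℝ) :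
    x ⬝ᵥ G *ᵥ y = ∑ i, ∑ j, x i * y j * G i j := by
  simp only [dotProduct, mulVec, Finset.mul_sum]
  refine Finset.sum_congr rfl fun i _ => Finset.sum_congr rfl fun j _ => by ring

lemma hadInv {ι : Type*} [Fintype ι] {B : Matrix ι ι ℝ} (hB : B.IsSymm)
    (hpos : ∀ i j, 0 < B i j) (u : ι → ℝ)
    (h : ∀ y, u ⬝ᵥ y = 0 → y ⬝ᵥ B *ᵥ y ≤ 0) (s : Finset ι) :
    (Matrix.of fun i j => if i ∈ s ∧ j ∈ s then (B i j)⁻¹ else 0 : Matrix ι ι ℝ).PosSemidef := by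
  induction s using Finset.induction_on with
  | empty =>
    convert Matrix.PosSemidef.zero (n := ι) (R := ℝ) using 1
    ext i j; simp
  | insert a s ha ih =>
    have hsy : ∀ i j, B i j = B j i := fun i j => (hB.apply i j).symm
    have hR : (Matrix.of fun i j => B a i * B a j - B a a * B i j : Matrix ι ι ℝ).PosSemidef := by
      refine .of_dotProduct_mulVec_nonneg ?_ fun x => ?_
      · ext i j; simp [hsy i j]; ring
      · have := revCS hB u h (Pi.single a 1) (by simpa using (hpos a a).le) x
        simp only [star_trivial]
        have e1 : (Pi.single a 1 : ι → ℝ) ⬝ᵥ B *ᵥ x = ∑ i, B a i * x i := by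
          rw [single_dotProduct, one_mul]; rfl
        have e2 : (Pi.single a 1 : ι → ℝ) ⬝ᵥ B *ᵥ (Pi.single a 1) = B a a := by simp
        have e3 : x ⬝ᵥ (Matrix.of fun i j => B a i * B a j - B a a * B i j : Matrix ι ι ℝ) *ᵥ x
            = (∑ i, B a i * x i) ^ 2 - B a a * (x ⬝ᵥ B *ᵥ x) := by
          rw [bil_eq, bil_eq, sq, Finset.sum_mul_sum, Finset.mul_sum, ← Finset.sum_sub_distrib]
          refine Finset.sum_congr rfl fun i _ => ?_
          rw [Finset.mul_sum, ← Finset.sum_sub_distrib]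
          refine Finset.sum_congr rfl fun j _ => ?_
          simp only [of_apply]; ring
        rw [e3]; rw [e1, e2] at this; linarith
    have h1 := Matrix.posSemidef_vecMulVec_self_star (R := ℝ) (fun i => (B a i)⁻¹)
    have h2 := Matrix.posSemidef_vecMulVec_self_star (R := ℝ)
      (fun i => if i ∈ insert a s then (B a i)⁻¹ else 0)
    have h3 := (h2.smul (hpos a a).le).add ((hR.hadamard h1).hadamard ih)
    convert h3 using 1
    ext i j
    have p1 := (hpos a i).ne'
    have p2 := (hpos a j).ne'
    have p3 := (hpos i j).ne'
    have p4 := (hpos a a).ne'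
    simp only [of_apply, Matrix.add_apply, Matrix.smul_apply, vecMulVec_apply, hadamard_apply, star_trivial,
      smul_eq_mul]
    by_cases hi : i ∈ s <;> by_cases hj : j ∈ s <;> by_cases hia : i = a <;>
      by_cases hja : j = a <;> simp_all
    · field_simp; ring
    · field_simp

open MeasureTheory in
lemma schoen {ι : Type*} [Fintype ι] {B : Matrix ι ι ℝ} (hB : B.IsSymm)
    (hnn : ∀ i j, 0 ≤ B i j)
    (h : ∀ y, ∑ i, y i = 0 → y ⬝ᵥ B *ᵥ y ≤ 0) (p : ℝ) (hp : p ∈ Set.Ioo (0 : ℝ) 1)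
    (x : ι → ℝ) (hx : ∑ i, x i = 0) :
    x ⬝ᵥ (Matrix.of fun i j => B i j ^ p : Matrix ι ι ℝ) *ᵥ x ≤ 0 := by
  obtain ⟨μ, hμ⟩ := Real.exists_measure_rpow_eq_integral_rpowIntegrand₀₁ hp
  have e : x ⬝ᵥ (Matrix.of fun i j => B i j ^ p : Matrix ι ι ℝ) *ᵥ x =
      ∫ t in Set.Ioi 0, ∑ i, ∑ j, x i * x j * Real.rpowIntegrand₀₁ p t (B i j) ∂μ := by
    rw [bil_eq, integral_finsetSum]
    · refine Finset.sum_congr rfl fun i _ => ?_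
      rw [integral_finsetSum]
      · refine Finset.sum_congr rfl fun j _ => ?_
        rw [integral_const_mul, ← (hμ _ (hnn i j)).2]; rfl
      · intro j _
        exact (hμ _ (hnn i j)).1.const_mul _
    · intro i _
      refine integrable_finsetSum _ fun j _ => ?_
      exact (hμ _ (hnn i j)).1.const_mul _
  rw [e]
  refine setIntegral_nonpos measurableSet_Ioi fun t ht => ?_
  have ht : 0 < t := ht
  have hh := hadInv (B := Matrix.of fun i j => t + B i j) (by
      ext i j; simp [hB.apply i j]) (fun i j => by simpa using add_pos_of_pos_of_nonneg ht (hnn i j))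
    1 (fun y hy => by
      have hy : ∑ i, y i = 0 := by simpa [dotProduct] using hy
      have := h y hy
      rw [bil_eq] at this ⊢
      simp only [of_apply, mul_add, Finset.sum_add_distrib]
      have z : ∑ i, ∑ j, y i * y j * t = 0 := by
        simp only [← Finset.sum_mul, ← Finset.mul_sum, hy]; simp
      rw [z]; linarith) Finset.univ
  have h2 := hh.dotProduct_mulVec_nonneg x
  rw [star_trivial, bil_eq] at h2
  simp only [of_apply, Finset.mem_univ, and_self, if_true] at h2
  have h3 : ∑ i, ∑ j, x i * x j * Real.rpowIntegrand₀₁ p t (B i j) =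
      t ^ p * (t⁻¹ * ((∑ i, x i) * ∑ j, x j) - ∑ i, ∑ j, x i * x j * (t + B i j)⁻¹) := by
    rw [Finset.sum_mul_sum]
    simp only [Finset.mul_sum, ← Finset.sum_sub_distrib]
    refine Finset.sum_congr rfl fun i _ => Finset.sum_congr rfl fun j _ => ?_
    rw [Real.rpowIntegrand₀₁]; ring
  rw [h3, hx]
  have : 0 < t ^ p := Real.rpow_pos_of_pos ht p
  nlinarith

lemma one_bil {ι : Type*} [Fintype ι] (H : Matrix ι ι ℝ) (hs : H.IsSymm) (x : ι → ℝ) :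
    (1 : ι → ℝ) ⬝ᵥ H *ᵥ x = ∑ i, (∑ j, H i j) * x i := by
  rw [bil_symm hs, bil_eq]
  refine Finset.sum_congr rfl fun i _ => ?_
  rw [Finset.sum_mul]
  refine Finset.sum_congr rfl fun j _ => ?_
  simp; ring

lemma one_bil_one {ι : Type*} [Fintype ι] (H : Matrix ι ι ℝ) :
    (1 : ι → ℝ) ⬝ᵥ H *ᵥ 1 = ∑ i, ∑ j, H i j := by
  rw [bil_eq]; simp

lemma lor_pow {ι : Type*} [Fintype ι] {H : Matrix ι ι ℝ} (hs : H.IsSymm)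
    (hnn : ∀ i j, 0 ≤ H i j) (hL : Lor H) (p : ℝ) (hp : p ∈ Set.Ioo (0 : ℝ) 1) :
    Lor (Matrix.of fun i j => H i j ^ p : Matrix ι ι ℝ) := by
  set v : ι → ℝ := fun i => ∑ j, H i j with hv
  have hv0 : ∀ i, 0 ≤ v i := fun i => Finset.sum_nonneg fun j _ => hnn i j
  have hz : ∀ i j, v i = 0 → H i j = 0 := fun i j hi =>
    (Finset.sum_eq_zero_iff_of_nonneg fun j _ => hnn i j).1 hi j (Finset.mem_univ _)
  have hsy : ∀ i j, H i j = H j i := fun i j => (hs.apply i j).symm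
  have hNSD : ∀ y, v ⬝ᵥ y = 0 → y ⬝ᵥ H *ᵥ y ≤ 0 := by
    intro y hy
    have h1 := hL y
    have h2 : (1 : ι → ℝ) ⬝ᵥ H *ᵥ y = 0 := by rw [one_bil H hs]; exact hy
    rw [h2] at h1
    have h3 : (1 : ι → ℝ) ⬝ᵥ H *ᵥ 1 = ∑ i, v i := one_bil_one H
    rcases (Finset.sum_nonneg fun i (_ : i ∈ Finset.univ) => hv0 i).eq_or_lt with h0 | h0
    · have h4 := (Finset.sum_eq_zero_iff_of_nonneg fun i _ => hv0 i).1 h0.symm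
      rw [bil_eq]
      refine le_of_eq (Finset.sum_eq_zero fun i _ => Finset.sum_eq_zero fun j _ => ?_)
      rw [hz i j (h4 i (Finset.mem_univ _)), mul_zero]
    · rw [h3] at h1; nlinarith
  have sumsub : ∀ f : ι → ℝ, (∀ i, v i = 0 → f i = 0) →
      ∑ i : {i // v i ≠ 0}, f i = ∑ i, f i := by
    intro f hf
    rw [← Finset.sum_subtype (Finset.univ.filter fun i => v i ≠ 0) (by simp) f]
    refine Finset.sum_subset (Finset.subset_univ _) fun i _ hi => hf i (by simpa using hi)
  intro x
  refine revCS ?_ (fun i => v i ^ p) ?_ 1 ?_ x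
  · ext i j; simp [hsy i j]
  · intro y hy
    let B : Matrix {i // v i ≠ 0} {i // v i ≠ 0} ℝ := Matrix.of fun i j => H i j / (v i * v j)
    have := schoen (B := B) (by ext i j; simp [B, hsy i.1 j.1, mul_comm])
      (fun i j => div_nonneg (hnn _ _) (mul_nonneg (hv0 _) (hv0 _))) ?_ p hp
      (fun i => y i * v i ^ p) ?_
    · convert this using 1
      rw [bil_eq, bil_eq]
      rw [← sumsub]
      · refine Finset.sum_congr rfl fun i _ => ?_
        rw [← sumsub]
        · refine Finset.sum_congr rfl fun j _ => ?_
          have a1 : 0 < v i := lt_of_le_of_ne (hv0 _) (Ne.symm i.2)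
          have a2 : 0 < v j := lt_of_le_of_ne (hv0 _) (Ne.symm j.2)
          have b1 := Real.rpow_pos_of_pos a1 p
          have b2 := Real.rpow_pos_of_pos a2 p
          simp only [B, of_apply]
          rw [Real.div_rpow (hnn _ _) (by positivity), Real.mul_rpow a1.le a2.le]
          field_simp
        · intro j hj
          simp [hsy i.1 j, hz j i.1 hj, Real.zero_rpow hp.1.ne']
      · intro i hi
        refine Finset.sum_eq_zero fun j _ => ?_
        simp [hz i j hi, Real.zero_rpow hp.1.ne']
    · intro z hz'
      have := hNSD (fun i => if h : v i ≠ 0 then z ⟨i, h⟩ / v i else 0) ?_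
      · convert this using 1
        rw [bil_eq, bil_eq]
        symm
        rw [← sumsub]
        · refine Finset.sum_congr rfl fun i _ => ?_
          rw [← sumsub]
          · refine Finset.sum_congr rfl fun j _ => ?_
            have a1 := i.2
            have a2 := j.2
            simp only [B, of_apply, dif_pos a1, dif_pos a2]
            field_simp
          · intro j hj
            simp [hj]
        · intro i hi
          simp [hi]
      · refine Eq.trans ?_ hz'
        rw [dotProduct, ← sumsub]
        · refine Finset.sum_congr rfl fun i _ => ?_
          have a1 := i.2
          simp only [dif_pos a1]
          field_simp
        · intro i hi
          simp [hi]
    · rw [sumsub (fun i => y i * v i ^ p)]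
      · rw [← hy]; simp [dotProduct, mul_comm]
      · intro i hi
        simp [hi, Real.zero_rpow hp.1.ne']
  · rw [one_bil_one]
    exact Finset.sum_nonneg fun i _ => Finset.sum_nonneg fun j _ => Real.rpow_nonneg (hnn i j) p

/-- power with `0 ↦ 0`. -/
def pw (α x : ℝ) : ℝ := if x = 0 then 0 else x ^ α

lemma pw_nonneg {α x : ℝ} (hx : 0 ≤ x) : 0 ≤ pw α x := by
  unfold pw; split_ifs; exacts [le_rfl, Real.rpow_nonneg hx α]

lemma pw_eq_zero {α x : ℝ} (hx : 0 ≤ x) : pw α x = 0 ↔ x = 0 := by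
  unfold pw
  constructor
  · intro h
    by_contra h0
    rw [if_neg h0] at h
    exact (Real.rpow_pos_of_pos (lt_of_le_of_ne hx (Ne.symm h0)) α).ne' h
  · intro h; simp [h]

lemma pw_of_pos {α : ℝ} (hα : 0 < α) (x : ℝ) : pw α x = x ^ α := by
  unfold pw; split_ifs with h
  · rw [h, Real.zero_rpow hα.ne']
  · rfl

open Filter Topology in
lemma pw_tendsto (x : ℝ) (hx : 0 ≤ x) :
    Tendsto (fun p : ℝ => x ^ p) (𝓝[>] 0) (𝓝 (pw 0 x)) := by
  by_cases h : x = 0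
  · have : pw 0 x = 0 := by simp [pw, h]
    rw [this]
    refine tendsto_const_nhds.congr' ?_
    filter_upwards [self_mem_nhdsWithin] with p hp
    rw [h, Real.zero_rpow (ne_of_gt hp)]
  · have : pw 0 x = x ^ (0 : ℝ) := by simp [pw, h]
    rw [this]
    exact ((Real.continuousAt_const_rpow h).tendsto).mono_left nhdsWithin_le_nhds

open Filter Topology in
lemma lor_pw {ι : Type*} [Fintype ι] {H : Matrix ι ι ℝ} (hs : H.IsSymm)
    (hnn : ∀ i j, 0 ≤ H i j) (hL : Lor H) (p : ℝ) (hp0 : 0 ≤ p) (hp1 : p ≤ 1) :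
    Lor (Matrix.of fun i j => pw p (H i j) : Matrix ι ι ℝ) := by
  rcases hp0.eq_or_lt with h0 | h0
  · subst h0
    intro x
    have T : ∀ y z : ι → ℝ, Tendsto (fun p : ℝ =>
        y ⬝ᵥ (Matrix.of fun i j => H i j ^ p : Matrix ι ι ℝ) *ᵥ z) (𝓝[>] 0)
        (𝓝 (y ⬝ᵥ (Matrix.of fun i j => pw 0 (H i j) : Matrix ι ι ℝ) *ᵥ z)) := by
      intro y z
      simp only [bil_eq, of_apply]
      exact tendsto_finsetSum _ fun i _ => tendsto_finsetSum _ fun j _ =>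
        (pw_tendsto _ (hnn i j)).const_mul _
    refine le_of_tendsto_of_tendsto ((T 1 1).mul (T x x)) ((T 1 x).pow 2) ?_
    have : Set.Ioo (0 : ℝ) 1 ∈ 𝓝[>] (0 : ℝ) := Ioo_mem_nhdsGT one_pos
    filter_upwards [this] with p hp
    exact lor_pow hs hnn hL p hp x
  · simp only [pw_of_pos h0]
    rcases hp1.eq_or_lt with h1 | h1
    · subst h1
      simp only [Real.rpow_one]; exact hL
    · exact lor_pow hs hnn hL p ⟨h0, h1⟩

lemma lor_conn {ι : Type*} [Fintype ι] {H : Matrix ι ι ℝ} (hs : H.IsSymm)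
    (hnn : ∀ i j, 0 ≤ H i j) (hL : Lor H) (x : ι → ℝ) (hx : ∀ i j, H i j ≠ 0 → x i = x j) :
    ∃ a, ∀ i, ∑ j, H i j ≠ 0 → x i = a := by
  set r : ι → ℝ := fun i => ∑ j, H i j with hr
  have hr0 : ∀ i, 0 ≤ r i := fun i => Finset.sum_nonneg fun j _ => hnn i j
  have h1 := hL x
  rw [one_bil_one, one_bil H hs] at h1
  have h2 : x ⬝ᵥ H *ᵥ x = ∑ i, r i * x i ^ 2 := by
    rw [bil_eq]
    refine Finset.sum_congr rfl fun i _ => ?_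
    rw [hr, Finset.sum_mul]
    refine Finset.sum_congr rfl fun j _ => ?_
    by_cases h : H i j = 0
    · simp [h]
    · rw [hx i j h]; ring
  rw [h2] at h1
  change (∑ i, r i) * _ ≤ (∑ i, r i * x i) ^ 2 at h1
  rcases (Finset.sum_nonneg fun i (_ : i ∈ Finset.univ) => hr0 i).eq_or_lt with h0 | h0
  · refine ⟨0, fun i hi => absurd ?_ hi⟩
    exact (Finset.sum_eq_zero_iff_of_nonneg fun i _ => hr0 i).1 h0.symm i (Finset.mem_univ _)
  set R := ∑ i, r i with hR
  set A := ∑ i, r i * x i with hA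
  refine ⟨A / R, fun i hi => ?_⟩
  have h3 : ∑ i, r i * (x i - A / R) ^ 2 = ∑ i, r i * x i ^ 2 - A ^ 2 / R := by
    have : ∀ i, r i * (x i - A / R) ^ 2 =
      r i * x i ^ 2 - 2 * (A / R) * (r i * x i) + (A / R) ^ 2 * r i := fun i => by ring
    simp only [this, Finset.sum_add_distrib, Finset.sum_sub_distrib, ← Finset.mul_sum]
    rw [← hR, ← hA]; field_simp; ring
  have h4 : ∑ i, r i * (x i - A / R) ^ 2 ≤ 0 := by
    rw [h3, sub_nonpos, le_div_iff₀ h0]; linarith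
  have h5 := (Finset.sum_eq_zero_iff_of_nonneg fun i _ =>
    mul_nonneg (hr0 i) (sq_nonneg (x i - A / R))).1
    (le_antisymm h4 (Finset.sum_nonneg fun i _ => mul_nonneg (hr0 i) (sq_nonneg _))) i
    (Finset.mem_univ _)
  rcases mul_eq_zero.1 h5 with h | h
  · exact absurd h hi
  · have := pow_eq_zero_iff (two_ne_zero) |>.1 h
    linarith

lemma trickle {ι : Type*} [Fintype ι] {H : Matrix ι ι ℝ} (hs : H.IsSymm)
    (hnn : ∀ i j, 0 ≤ H i j)
    (hconn : ∀ x : ι → ℝ, (∀ i j, H i j ≠ 0 → x i = x j) → ∃ a, ∀ i, ∑ j, H i j ≠ 0 → x i = a)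
    (hT : ∀ x : ι → ℝ, x ⬝ᵥ H *ᵥ x ≤ ∑ i, (∑ j, H i j * x j) ^ 2 / (∑ j, H i j)) : Lor H := by
  have hsy : ∀ i j, H i j = H j i := fun i j => (hs.apply i j).symm
  set r : ι → ℝ := fun i => ∑ j, H i j with hr
  have hr0 : ∀ i, 0 ≤ r i := fun i => Finset.sum_nonneg fun j _ => hnn i j
  have hz : ∀ i j, r i = 0 → H i j = 0 := fun i j hi =>
    (Finset.sum_eq_zero_iff_of_nonneg fun j _ => hnn i j).1 hi j (Finset.mem_univ _)
  set w : ι → ℝ := fun i => √(r i) with hw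
  have hww : ∀ i, w i * w i = r i := fun i => Real.mul_self_sqrt (hr0 i)
  have hw0 : ∀ i, w i = 0 → r i = 0 := fun i h => by rw [← hww i, h, mul_zero]
  have hzw : ∀ i j, w i = 0 → H i j = 0 := fun i j h => hz i j (hw0 i h)
  have hzw' : ∀ i j, w j = 0 → H i j = 0 := fun i j h => by rw [hsy]; exact hz j i (hw0 j h)
  set R := ∑ i, r i with hR
  intro x
  rw [one_bil_one, one_bil H hs]
  change R * _ ≤ (∑ i, r i * x i) ^ 2
  rcases (Finset.sum_nonneg fun i (_ : i ∈ Finset.univ) => hr0 i).eq_or_lt with h0 | h0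
  · rw [← hR] at h0; rw [← h0, zero_mul]; positivity
  rw [← hR] at h0
  let M : Matrix ι ι ℝ := Matrix.of fun i j => H i j / (w i * w j)
  let N : Matrix ι ι ℝ := Matrix.of fun i j => w i * w j / R - H i j / (w i * w j)
  have hN : N.IsHermitian := by
    ext i j
    simp only [N, conjTranspose_apply, of_apply, star_trivial, hsy i j, mul_comm]
  have hNe : ∀ y : ι → ℝ, ∀ i, (N *ᵥ y) i = w i * (∑ j, w j * y j) / R
      - ∑ j, H i j / (w i * w j) * y j := by
    intro y i
    simp only [mulVec, dotProduct, N, of_apply, sub_mul, Finset.sum_sub_distrib]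
    rw [Finset.mul_sum, Finset.sum_div]
    congr 1
    exact Finset.sum_congr rfl fun j _ => by ring
  have hwM : ∀ j, ∑ i, w i * (H i j / (w i * w j)) = w j := by
    intro j
    by_cases hj : w j = 0
    · simp [hj]
    have : ∀ i, w i * (H i j / (w i * w j)) = H j i / w j := by
      intro i
      by_cases hi : w i = 0
      · simp [hi, hzw' j i hi]
      · rw [hsy i j]; field_simp
    simp only [this, ← Finset.sum_div]
    change r j / w j = w j
    rw [← hww]; field_simp
  have hPSD : N.PosSemidef := by
    rw [hN.posSemidef_iff_eigenvalues_nonneg]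
    intro e
    by_contra hneg
    simp only [Pi.zero_apply, not_le] at hneg
    set l := - hN.eigenvalues e with hl
    have hlpos : 0 < l := by linarith
    set y : ι → ℝ := ⇑(hN.eigenvectorBasis e) with hy
    have hey : ∀ i, (N *ᵥ y) i = - l * y i := by
      intro i
      have := congrFun (hN.mulVec_eigenvectorBasis e) i
      rw [hl, neg_neg]; exact this
    have hyne : y ≠ 0 := by
      intro h
      have h1 := hN.eigenvectorBasis.orthonormal.ne_zero e
      apply h1
      ext i
      exact congrFun h i
    have hwy : ∑ j, w j * y j = 0 := by
      have h1 : ∑ i, w i * (N *ᵥ y) i = 0 := by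
        simp only [hNe, mul_sub, Finset.sum_sub_distrib]
        have a1 : ∑ i, w i * (w i * (∑ j, w j * y j) / R) = ∑ j, w j * y j := by
          have : ∀ i, w i * (w i * (∑ j, w j * y j) / R) = r i * ((∑ j, w j * y j) / R) :=
            fun i => by rw [← hww]; ring
          simp only [this, ← Finset.sum_mul]
          rw [← hR]; field_simp
        have a2 : ∑ i, w i * ∑ j, H i j / (w i * w j) * y j = ∑ j, w j * y j := by
          simp only [Finset.mul_sum]
          rw [Finset.sum_comm]
          refine Finset.sum_congr rfl fun j _ => ?_
          simp only [← mul_assoc, ← Finset.sum_mul, hwM]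
        rw [a1, a2, sub_self]
      simp only [hey] at h1
      have h2 : ∑ i, w i * (-l * y i) = -l * ∑ i, w i * y i := by
        rw [Finset.mul_sum]; exact Finset.sum_congr rfl fun j _ => by ring
      rw [h2] at h1
      rcases mul_eq_zero.1 h1 with h | h
      · linarith
      · exact h
    have hMy : ∀ i, ∑ j, H i j / (w i * w j) * y j = l * y i := by
      intro i
      have := hey i
      rw [hNe, hwy] at this
      simp at this; linarith
    have hy0 : ∀ i, w i = 0 → y i = 0 := by
      intro i hi
      have := hMy i
      simp [hi] at this
      rcases this with h | h
      · linarith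
      · exact h
    set z : ι → ℝ := fun i => y i / w i with hzd
    have hwz : ∀ i, w i * z i = y i := by
      intro i
      by_cases hi : w i = 0
      · simp [hi, hy0 i hi]
      · rw [hzd]; field_simp
    have hHz : ∀ i, ∑ j, H i j * z j = l * w i * y i := by
      intro i
      by_cases hi : w i = 0
      · simp [hi, hzw i _ hi]
      rw [mul_comm l, mul_assoc, ← hMy, Finset.mul_sum]
      refine Finset.sum_congr rfl fun j _ => ?_
      by_cases hj : w j = 0
      · simp [hj, hzd]
      · rw [hzd]; field_simp
    have hQ : z ⬝ᵥ H *ᵥ z = l * ∑ i, y i ^ 2 := by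
      simp only [dotProduct, mulVec, hHz]
      rw [Finset.mul_sum]
      refine Finset.sum_congr rfl fun i _ => ?_
      rw [← hwz i]; ring
    have hT1 := hT z
    have hT2 : ∑ i, (∑ j, H i j * z j) ^ 2 / r i = l ^ 2 * ∑ i, y i ^ 2 := by
      simp only [hHz]
      rw [Finset.mul_sum]
      refine Finset.sum_congr rfl fun i _ => ?_
      by_cases hi : w i = 0
      · simp [hi, hy0 i hi]
      · rw [← hww]; field_simp
    rw [hQ, hT2] at hT1
    have hYpos : 0 < ∑ i, y i ^ 2 := by
      obtain ⟨i, hi⟩ := Function.ne_iff.1 hyne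
      exact Finset.sum_pos' (fun i _ => sq_nonneg _) ⟨i, Finset.mem_univ _, by
        have : y i ≠ 0 := hi
        positivity⟩
    have hl1 : 1 ≤ l := by
      have : l * 1 ≤ l * l := by nlinarith
      exact le_of_mul_le_mul_left this hlpos
    have hD : ∑ i, ∑ j, H i j * (z i - z j) ^ 2 = 2 * (∑ i, y i ^ 2 - l * ∑ i, y i ^ 2) := by
      rw [← hQ, bil_eq]
      have b1 : ∑ i, y i ^ 2 = ∑ i, ∑ j, H i j * z i ^ 2 := by
        refine Finset.sum_congr rfl fun i _ => ?_
        rw [← Finset.sum_mul]; change _ = r i * _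
        rw [← hwz, ← hww]; ring
      have b2 : ∑ i, y i ^ 2 = ∑ i, ∑ j, H i j * z j ^ 2 := by
        rw [b1, Finset.sum_comm]
        exact Finset.sum_congr rfl fun i _ => Finset.sum_congr rfl fun j _ => by rw [hsy]
      have b3 : 2 * (∑ i, y i ^ 2 - ∑ i, ∑ j, z i * z j * H i j) =
        ∑ i, y i ^ 2 + ∑ i, y i ^ 2 - ∑ i, ∑ j, 2 * (z i * z j * H i j) := by
        simp only [← Finset.mul_sum]; ring
      rw [b3]; nth_rewrite 1 [b1]; rw [b2]
      simp only [← Finset.sum_add_distrib, ← Finset.sum_sub_distrib]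
      exact Finset.sum_congr rfl fun i _ => Finset.sum_congr rfl fun j _ => by ring
    have hD0 : ∑ i, ∑ j, H i j * (z i - z j) ^ 2 ≤ 0 := by rw [hD]; nlinarith
    have hn1 : ∀ i j, 0 ≤ H i j * (z i - z j) ^ 2 := fun i j => mul_nonneg (hnn i j) (sq_nonneg _)
    have hn2 : ∀ i, 0 ≤ ∑ j, H i j * (z i - z j) ^ 2 := fun i => Finset.sum_nonneg fun j _ => hn1 i j
    have hD1 := (Finset.sum_eq_zero_iff_of_nonneg fun i _ => hn2 i).1
      (le_antisymm hD0 (Finset.sum_nonneg fun i _ => hn2 i))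
    obtain ⟨a, ha⟩ := hconn z (fun i j hij => by
      have := (Finset.sum_eq_zero_iff_of_nonneg fun j _ => hn1 i j).1
        (hD1 i (Finset.mem_univ _)) j (Finset.mem_univ _)
      rcases mul_eq_zero.1 this with h | h
      · exact absurd h hij
      · have := pow_eq_zero_iff (two_ne_zero) |>.1 h
        linarith)
    have hra : ∀ i, w i * y i = r i * a := by
      intro i
      by_cases hi : r i = 0
      · rw [← hwz, ← mul_assoc, hww, hi]; simp
      · rw [← hwz, ha i hi, ← mul_assoc, hww]
    simp only [hra, ← Finset.sum_mul] at hwy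
    have ha0 : a = 0 := by
      rcases mul_eq_zero.1 hwy with h | h
      · exact absurd h h0.ne'
      · exact h
    apply hyne
    ext i
    by_cases hi : w i = 0
    · exact hy0 i hi
    · have := hra i
      rw [ha0, mul_zero] at this
      exact (mul_eq_zero.1 this).resolve_left hi
  have hfin := hPSD.dotProduct_mulVec_nonneg (fun i => w i * x i)
  rw [star_trivial, bil_eq] at hfin
  have hf : ∑ i, ∑ j, (w i * x i) * (w j * x j) * N i j
      = (∑ i, r i * x i) ^ 2 / R - x ⬝ᵥ H *ᵥ x := by
    rw [bil_eq, sq, Finset.sum_mul_sum, Finset.sum_div, ← Finset.sum_sub_distrib]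
    refine Finset.sum_congr rfl fun i _ => ?_
    rw [Finset.sum_div, ← Finset.sum_sub_distrib]
    refine Finset.sum_congr rfl fun j _ => ?_
    simp only [N, of_apply]
    rw [← hww i, ← hww j]
    by_cases hi : w i = 0
    · simp [hi, hzw i j hi]
    by_cases hj : w j = 0
    · simp [hj, hzw' i j hj]
    field_simp
  rw [hf, sub_nonneg, le_div_iff₀ h0] at hfin
  linarith

/-- Value at `𝟙` of an iterated derivative of the multiaffine polynomial. -/
def EE {n : ℕ} (c : Finset (Fin n) → ℝ) (k : ℕ) (l : List (Fin n)) : ℝ :=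
  ∑ S ∈ Finset.univ.filter (fun S : Finset (Fin n) => S.card = k),
    if l.Nodup ∧ l.toFinset ⊆ S then c S else 0

/-- The multiaffine polynomial. -/
def PP {n : ℕ} (c : Finset (Fin n) → ℝ) (k : ℕ) : MP n :=
  ∑ S ∈ Finset.univ.filter (fun S : Finset (Fin n) => S.card = k), C (c S) * ∏ i ∈ S, X i

lemma pderiv_prodX {n : ℕ} (i : Fin n) (T : Finset (Fin n)) :
    pderiv i (∏ j ∈ T, X j : MP n) = if i ∈ T then ∏ j ∈ T.erase i, X j else 0 := by
  induction T using Finset.induction_on with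
  | empty => simp
  | insert a s ha ih =>
    rw [Finset.prod_insert ha, pderiv_mul, ih]
    by_cases hia : i = a
    · subst hia
      simp [ha]
    · have hai : a ≠ i := fun h => hia h.symm
      rw [pderiv_X_of_ne hai]
      by_cases his : i ∈ s
      · have : (insert a s).erase i = insert a (s.erase i) := Finset.erase_insert_of_ne hai
        simp [his, this, Finset.prod_insert, ha]
      · simp [his, hia]

lemma derivList_mono {n : ℕ} (a : ℝ) (S : Finset (Fin n)) (l : List (Fin n)) :
    derivList l (C a * ∏ i ∈ S, X i : MP n) =
      if l.Nodup ∧ l.toFinset ⊆ S then C a * ∏ i ∈ S \ l.toFinset, X i else 0 := by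
  induction l with
  | nil => simp [derivList]
  | cons i l ih =>
    have : derivList (i :: l) (C a * ∏ i ∈ S, X i : MP n) =
      pderiv i (derivList l (C a * ∏ i ∈ S, X i : MP n)) := rfl
    rw [this, ih]
    by_cases h : l.Nodup ∧ l.toFinset ⊆ S
    · rw [if_pos h, pderiv_C_mul, pderiv_prodX]
      by_cases hi : i ∈ S \ l.toFinset
      · have hi' := Finset.mem_sdiff.1 hi
        rw [if_pos hi, if_pos]
        · congr 2
          ext j; simp; tauto
        · refine ⟨List.nodup_cons.2 ⟨by simpa using hi'.2, h.1⟩, ?_⟩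
          rw [List.toFinset_cons, Finset.insert_subset_iff]
          exact ⟨hi'.1, h.2⟩
      · rw [if_neg hi, if_neg, mul_zero]
        rintro ⟨h1, h2⟩
        apply hi
        rw [List.toFinset_cons, Finset.insert_subset_iff] at h2
        exact Finset.mem_sdiff.2 ⟨h2.1, by simpa using (List.nodup_cons.1 h1).1⟩
    · rw [if_neg h, if_neg, map_zero]
      rintro ⟨h1, h2⟩
      apply h
      rw [List.toFinset_cons, Finset.insert_subset_iff] at h2
      exact ⟨(List.nodup_cons.1 h1).2, h2.2⟩

lemma derivList_sum {n : ℕ} {ι : Type*} (s : Finset ι) (f : ι → MP n) (l : List (Fin n)) :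
    derivList l (∑ i ∈ s, f i) = ∑ i ∈ s, derivList l (f i) := by
  induction l with
  | nil => simp [derivList]
  | cons i l ih =>
    change pderiv i (derivList l _) = ∑ j ∈ s, pderiv i (derivList l (f j))
    rw [ih, map_sum]

lemma eval_derivList_s11 {n : ℕ} (c : Finset (Fin n) → ℝ) (k : ℕ) (l : List (Fin n)) :
    eval (fun _ => (1 : ℝ)) (derivList l (PP c k)) = EE c k l := by
  rw [PP, derivList_sum, map_sum, EE]
  refine Finset.sum_congr rfl fun S _ => ?_
  rw [derivList_mono]
  split_ifs <;> simp

lemma EE_perm {n : ℕ} (c : Finset (Fin n) → ℝ) (k : ℕ) {l l' : List (Fin n)} (h : l.Perm l') :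
    EE c k l = EE c k l' := by
  unfold EE
  simp only [h.nodup_iff, List.toFinset_eq_of_perm _ _ h]

lemma EE_nonneg {n : ℕ} {c : Finset (Fin n) → ℝ} (hc : ∀ S, 0 ≤ c S) (k : ℕ)
    (l : List (Fin n)) : 0 ≤ EE c k l :=
  Finset.sum_nonneg fun S _ => by split_ifs; exacts [hc S, le_rfl]

lemma EE_euler {n : ℕ} (c : Finset (Fin n) → ℝ) (k : ℕ) (l : List (Fin n)) :
    ∑ i, EE c k (i :: l) = ((k : ℝ) - l.length) * EE c k l := by
  unfold EE
  rw [Finset.sum_comm, Finset.mul_sum]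
  refine Finset.sum_congr rfl fun S hS => ?_
  have hS : S.card = k := by simpa using hS
  by_cases h : l.Nodup ∧ l.toFinset ⊆ S
  · rw [if_pos h]
    have : ∀ i, (if (i :: l).Nodup ∧ (i :: l).toFinset ⊆ S then c S else 0) =
        if i ∈ S \ l.toFinset then c S else 0 := by
      intro i
      congr 1
      rw [List.nodup_cons, List.toFinset_cons, Finset.insert_subset_iff, Finset.mem_sdiff,
        List.mem_toFinset]
      have := h.1
      have := h.2
      apply propext; tauto
    simp only [this]
    rw [Finset.sum_ite_mem, Finset.univ_inter, Finset.sum_const, nsmul_eq_mul,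
      Finset.cast_card_sdiff h.2, hS, List.toFinset_card_of_nodup h.1]
  · rw [if_neg h, mul_zero]
    refine Finset.sum_eq_zero fun i _ => if_neg ?_
    rintro ⟨h1, h2⟩
    apply h
    rw [List.toFinset_cons, Finset.insert_subset_iff] at h2
    exact ⟨(List.nodup_cons.1 h1).2, h2.2⟩

lemma EE_zero {n : ℕ} (c : Finset (Fin n) → ℝ) (k : ℕ) (l : List (Fin n)) (h : k < l.length) :
    EE c k l = 0 := by
  refine Finset.sum_eq_zero fun S hS => if_neg ?_
  have hS : S.card = k := by simpa using hS
  rintro ⟨h1, h2⟩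
  have := Finset.card_le_card h2
  rw [List.toFinset_card_of_nodup h1] at this
  omega

lemma EE_top {n : ℕ} (c : Finset (Fin n) → ℝ) (k : ℕ) (l : List (Fin n)) (h : l.length = k) :
    EE c k l = if l.Nodup then c l.toFinset else 0 := by
  unfold EE
  by_cases hn : l.Nodup
  · rw [if_pos hn]
    have hc : l.toFinset.card = k := by rw [List.toFinset_card_of_nodup hn, h]
    rw [Finset.sum_eq_single l.toFinset]
    · simp [hn]
    · intro S hS hne
      have hS : S.card = k := by simpa using hS
      refine if_neg ?_
      rintro ⟨_, h2⟩
      exact hne (Finset.eq_of_subset_of_card_le h2 (by omega)).symm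
    · intro h3
      simp [hc] at h3
  · simp [hn]

lemma EE_pw {n : ℕ} {c : Finset (Fin n) → ℝ} (α : ℝ) (k : ℕ)
    (l : List (Fin n)) (h : l.length = k) :
    EE (fun S => pw α (c S)) k l = pw α (EE c k l) := by
  rw [EE_top _ _ _ h, EE_top _ _ _ h]
  split_ifs
  · rfl
  · simp [pw]

lemma EE_pw_zero {n : ℕ} {c : Finset (Fin n) → ℝ} (hc : ∀ S, 0 ≤ c S) (α : ℝ) (k : ℕ)
    (l : List (Fin n)) : EE (fun S => pw α (c S)) k l = 0 ↔ EE c k l = 0 := by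
  unfold EE
  rw [Finset.sum_eq_zero_iff_of_nonneg, Finset.sum_eq_zero_iff_of_nonneg]
  · refine forall₂_congr fun S _ => ?_
    split_ifs
    · exact pw_eq_zero (hc S)
    · rfl
  · intro S _; split_ifs; exacts [hc S, le_rfl]
  · intro S _; split_ifs; exacts [pw_nonneg (hc S), le_rfl]

/-- Hessian. -/
def HH {n : ℕ} (c : Finset (Fin n) → ℝ) (k : ℕ) (l : List (Fin n)) : Matrix (Fin n) (Fin n) ℝ :=
  Matrix.of fun i j => EE c k (i :: j :: l)

lemma HH_symm {n : ℕ} (c : Finset (Fin n) → ℝ) (k : ℕ) (l : List (Fin n)) : (HH c k l).IsSymm := by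
  ext i j
  exact EE_perm c k (List.Perm.swap _ _ _)

lemma HH_row {n : ℕ} (c : Finset (Fin n) → ℝ) (k : ℕ) (l : List (Fin n)) (i : Fin n) :
    ∑ j, HH c k l i j = ((k : ℝ) - l.length - 1) * EE c k (i :: l) := by
  have : ∀ j, HH c k l i j = EE c k (j :: i :: l) := fun j => EE_perm c k (List.Perm.swap _ _ _)
  simp only [this, EE_euler, List.length_cons]
  push_cast; ring

lemma HH_one {n : ℕ} (c : Finset (Fin n) → ℝ) (k : ℕ) (l : List (Fin n)) (x : Fin n → ℝ) :
    (1 : Fin n → ℝ) ⬝ᵥ HH c k l *ᵥ x = ((k : ℝ) - l.length - 1) * ∑ i, EE c k (i :: l) * x i := by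
  rw [one_bil _ (HH_symm c k l)]
  simp only [HH_row, Finset.mul_sum, mul_assoc]

lemma HH_one_one {n : ℕ} (c : Finset (Fin n) → ℝ) (k : ℕ) (l : List (Fin n)) :
    (1 : Fin n → ℝ) ⬝ᵥ HH c k l *ᵥ 1 =
      ((k : ℝ) - l.length - 1) * (((k : ℝ) - l.length) * EE c k l) := by
  rw [HH_one, ← EE_euler]; simp

lemma LC_iff {n : ℕ} (c : Finset (Fin n) → ℝ) (k : ℕ) (l : List (Fin n)) :
    LogConcaveAtOne (derivList l (PP c k)) ↔
      ∀ x : Fin n → ℝ, EE c k l * (x ⬝ᵥ HH c k l *ᵥ x) ≤ (∑ i, EE c k (i :: l) * x i) ^ 2 := by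
  have e1 : gradOne (derivList l (PP c k)) = fun i => EE c k (i :: l) := by
    ext i; exact eval_derivList_s11 c k (i :: l)
  have e2 : hessOne (derivList l (PP c k)) = HH c k l := by
    ext i j; exact eval_derivList_s11 c k (i :: j :: l)
  rw [LogConcaveAtOne, e1, e2, eval_derivList_s11, posSemidef_iff_dotProduct_mulVec]
  have key : ∀ x : Fin n → ℝ, star x ⬝ᵥ (vecMulVec (fun i => EE c k (i :: l))
      (fun i => EE c k (i :: l)) - EE c k l • HH c k l) *ᵥ x =
      (∑ i, EE c k (i :: l) * x i) ^ 2 - EE c k l * (x ⬝ᵥ HH c k l *ᵥ x) := by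
    intro x
    rw [star_trivial, sub_mulVec, dotProduct_sub, smul_mulVec, dotProduct_smul, smul_eq_mul]
    congr 1
    rw [bil_eq, sq, Finset.sum_mul_sum]
    refine Finset.sum_congr rfl fun i _ => Finset.sum_congr rfl fun j _ => ?_
    rw [vecMulVec_apply]; ring
  simp only [key, sub_nonneg]
  constructor
  · exact fun h => h.2
  · refine fun h => ⟨?_, h⟩
    ext i j
    have := (HH_symm c k l).apply i j
    simp only [conjTranspose_apply, Matrix.sub_apply, Matrix.smul_apply, vecMulVec_apply,
      star_trivial, this, mul_comm]

lemma LC_lor {n : ℕ} {c : Finset (Fin n) → ℝ} (hc : ∀ S, 0 ≤ c S) (k : ℕ) (l : List (Fin n))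
    (hl : l.length + 2 ≤ k) (h : LogConcaveAtOne (derivList l (PP c k))) : Lor (HH c k l) := by
  rw [LC_iff] at h
  have hk : (l.length : ℝ) + 2 ≤ k := by exact_mod_cast hl
  intro x
  rcases (EE_nonneg hc k l).eq_or_lt with h0 | h0
  · rw [HH_one_one, ← h0]; simp; positivity
  · refine revCS (HH_symm c k l) (fun i => EE c k (i :: l)) (fun y hy => ?_) 1 ?_ x
    · have h1 := h y
      have hy : ∑ i, EE c k (i :: l) * y i = 0 := hy
      rw [hy] at h1
      nlinarith
    · rw [HH_one_one]
      exact mul_nonneg (by linarith) (mul_nonneg (by linarith) h0.le)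

lemma lor_LC {n : ℕ} {c : Finset (Fin n) → ℝ} (k : ℕ) (l : List (Fin n))
    (hl : l.length + 2 ≤ k) (h : Lor (HH c k l)) : LogConcaveAtOne (derivList l (PP c k)) := by
  rw [LC_iff]
  have hk : (l.length : ℝ) + 2 ≤ k := by exact_mod_cast hl
  intro x
  have h1 := h x
  rw [HH_one_one, HH_one] at h1
  set L := ∑ i, EE c k (i :: l) * x i
  set Q := x ⬝ᵥ HH c k l *ᵥ x
  set E := EE c k l
  obtain ⟨d, hd⟩ : ∃ d : ℝ, d = (k : ℝ) - l.length := ⟨_, rfl⟩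
  rw [← hd] at h1
  have hd2 : 2 ≤ d := by linarith
  have h2 : (d - 1) * (d * (E * Q)) ≤ (d - 1) * ((d - 1) * L ^ 2) := by nlinarith
  have h3 := le_of_mul_le_mul_left h2 (by linarith)
  have h4 : d * (E * Q) ≤ d * L ^ 2 := by nlinarith [sq_nonneg L]
  exact le_of_mul_le_mul_left h4 (by linarith)

lemma lor_main {n : ℕ} {c : Finset (Fin n) → ℝ} (hc : ∀ S, 0 ≤ c S) (k : ℕ)
    (h : StronglyLogConcaveAtOne (PP c k)) (α : ℝ) (h0 : 0 ≤ α) (h1 : α ≤ 1) (d : ℕ) :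
    ∀ l : List (Fin n), l.length + d + 2 = k → Lor (HH (fun S => pw α (c S)) k l) := by
  have hc' : ∀ S, 0 ≤ pw α (c S) := fun S => pw_nonneg (hc S)
  induction d with
  | zero =>
    intro l hl
    have := lor_pw (HH_symm c k l) (fun i j => EE_nonneg hc k _)
      (LC_lor hc k l (by omega) (h l)) α h0 h1
    convert this using 1
    ext i j
    exact EE_pw α k (i :: j :: l) (by simp only [List.length_cons]; omega)
  | succ d ih =>
    intro l hl
    have hkl : (k : ℝ) - l.length - 1 = d + 2 := by
      rw [← hl]; push_cast; ring
    set g : Finset (Fin n) → ℝ := fun S => pw α (c S) with hg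
    have hL := LC_lor hc k l (by omega) (h l)
    refine trickle (HH_symm g k l) (fun i j => EE_nonneg hc' k _) ?_ ?_
    · intro x hx
      obtain ⟨a, ha⟩ := lor_conn (HH_symm c k l) (fun i j => EE_nonneg hc k _) hL x
        (fun i j hij => hx i j fun h => hij ((EE_pw_zero hc α k _).1 h))
      refine ⟨a, fun i hi => ha i fun h => hi ?_⟩
      rw [HH_row] at h ⊢
      rcases mul_eq_zero.1 h with h | h
      · rw [h, zero_mul]
      · rw [(EE_pw_zero hc α k _).2 h, mul_zero]
    · intro x
      have hi : ∀ i, x ⬝ᵥ HH g k (i :: l) *ᵥ x ≤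
          (d + 1) * ((∑ j, HH g k l i j * x j) ^ 2 / ∑ j, HH g k l i j) := by
        intro i
        have hLi := ih (i :: l) (by simp; omega) x
        have e1 : ∑ j, EE g k (j :: i :: l) * x j = ∑ j, HH g k l i j * x j :=
          Finset.sum_congr rfl fun j _ => by
            rw [EE_perm g k (List.Perm.swap i j l)]; rfl
        have hlen : (k : ℝ) - (i :: l).length - 1 = d + 1 := by
          simp only [List.length_cons]; push_cast; linarith
        have hlen2 : (k : ℝ) - (i :: l).length = d + 2 := by linarith
        rw [HH_one_one, HH_one, e1, hlen, hlen2] at hLi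
        rw [HH_row, hkl]
        rcases (EE_nonneg hc' k (i :: l)).eq_or_lt with hz | hpos
        · rw [← hg] at hz
          have hrow : ∑ a, ∑ b, HH g k (i :: l) a b = 0 := by
            rw [← one_bil_one, HH_one_one, ← hz]; simp
          have hn1 : ∀ a b, 0 ≤ HH g k (i :: l) a b := fun a b => EE_nonneg hc' k _
          have hz1 : ∀ a b, HH g k (i :: l) a b = 0 := fun a b =>
            (Finset.sum_eq_zero_iff_of_nonneg fun b _ => hn1 a b).1
              ((Finset.sum_eq_zero_iff_of_nonneg fun a _ =>
                Finset.sum_nonneg fun b _ => hn1 a b).1 hrow a (Finset.mem_univ _)) b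
                (Finset.mem_univ _)
          rw [bil_eq, ← hz]
          simp [hz1]
        · rw [← hg] at hpos
          set e := EE g k (i :: l)
          set Q := x ⬝ᵥ HH g k (i :: l) *ᵥ x
          set A := ∑ j, HH g k l i j * x j
          have hd : (0 : ℝ) ≤ d := Nat.cast_nonneg d
          rw [← mul_div_assoc, le_div_iff₀ (by positivity)]
          have : (d + 1 : ℝ) * (Q * ((d + 2) * e)) ≤ (d + 1) * ((d + 1) * A ^ 2) := by nlinarith
          exact le_of_mul_le_mul_left this (by positivity)
      have hsum := Finset.sum_le_sum fun i (_ : i ∈ Finset.univ) => hi i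
      rw [← Finset.mul_sum] at hsum
      have e2 : ∑ i, x ⬝ᵥ HH g k (i :: l) *ᵥ x = (d + 1) * (x ⬝ᵥ HH g k l *ᵥ x) := by
        simp only [bil_eq]
        rw [Finset.sum_comm, Finset.mul_sum]
        refine Finset.sum_congr rfl fun a _ => ?_
        rw [Finset.sum_comm, Finset.mul_sum]
        refine Finset.sum_congr rfl fun b _ => ?_
        rw [← Finset.mul_sum]
        have : ∑ i, HH g k (i :: l) a b = ∑ i, EE g k (i :: a :: b :: l) :=
          Finset.sum_congr rfl fun i _ => EE_perm g k
            (((List.Perm.swap i b l).cons a).trans (List.Perm.swap i a (b :: l)))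
        rw [this, EE_euler]
        have : (k : ℝ) - (a :: b :: l).length = d + 1 := by
          simp only [List.length_cons]; push_cast; linarith
        rw [this]
        simp only [HH, of_apply]; ring
      rw [e2] at hsum
      exact le_of_mul_le_mul_left hsum (by positivity)

lemma slc_main {n : ℕ} {c : Finset (Fin n) → ℝ} (hc : ∀ S, 0 ≤ c S) (k : ℕ)
    (h : StronglyLogConcaveAtOne (PP c k)) (α : ℝ) (h0 : 0 ≤ α) (h1 : α ≤ 1) :
    StronglyLogConcaveAtOne (PP (fun S => pw α (c S)) k) := by
  intro l
  by_cases hl : l.length + 2 ≤ k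
  · exact lor_LC k l hl (lor_main hc k h α h0 h1 (k - l.length - 2) l (by omega))
  · rw [LC_iff]
    intro x
    have : x ⬝ᵥ HH (fun S => pw α (c S)) k l *ᵥ x = 0 := by
      rw [bil_eq]
      refine Finset.sum_eq_zero fun i _ => Finset.sum_eq_zero fun j _ => ?_
      rw [HH, of_apply, EE_zero _ _ _ (by simp; omega), mul_zero]
    rw [this, mul_zero]; positivity

theorem stmt11 (n k : ℕ) (c : Finset (Fin n) → ℝ) (hnn : ∀ S, 0 ≤ c S)
    (hslc : StronglyLogConcaveAtOne
      (∑ S ∈ Finset.univ.filter (fun S : Finset (Fin n) => S.card = k),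
        C (c S) * ∏ i ∈ S, X i))
    (α : ℝ) (hα0 : 0 ≤ α) (hα1 : α ≤ 1) :
    StronglyLogConcaveAtOne
      (∑ S ∈ Finset.univ.filter (fun S : Finset (Fin n) => S.card = k),
        C (if c S = 0 then 0 else c S ^ α) * ∏ i ∈ S, X i) := by
  exact slc_main hnn k hslc α hα0 hα1

end
end
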